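/- arXiv:0711.4093 — 2 statements merged into one kernel-verified Lean document; each statement's English description precedes it below -/
import Mathlib

section
/- If a group G acts with finite stabilizers on a finite dimensional contractible simplicial complex X, then: (1) the rational cohomological dimension satisfies cd_ℚ G ≤ dim X; (2) there exists a free ℚG-module F = ⊕_i ℚG and a natural number n' ≤ dim X such that H^{n'}(G; F) ≠ 0; (3) there exists a free ℤG-module F̃ = ⊕_j ℤG and n equal to n' or n'+1 such that H^{n}(G; F̃) ≠ 0. -/
universe u

/-- An abstract simplicial complex on a vertex type `V`: a downward-closed
family of nonempty finite subsets of `V`. -/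
structure SComplex (V : Type u) where
  faces : Set (Finset V)
  nonempty_of_mem : ∀ σ ∈ faces, σ.Nonempty
  down_closed : ∀ σ ∈ faces, ∀ τ : Finset V, τ ⊆ σ → τ.Nonempty → τ ∈ faces

namespace SComplex

variable {V : Type u} [DecidableEq V]

/-- The vertex set of a simplicial complex. -/
def vertexSet (X : SComplex V) : Set V := {v | ({v} : Finset V) ∈ X.faces}

/-- The geometric realization of a simplicial complex: the set of barycentric
coordinate functions supported on a simplex, inside the product space `V → ℝ`. -/
def realization (X : SComplex V) : Set (V → ℝ) :=
  {f | (∀ v, 0 ≤ f v) ∧ ∃ σ ∈ X.faces, (∀ v, v ∉ σ → f v = 0) ∧ ∑ v ∈ σ, f v = 1}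

/-- `Y` is a subcomplex of `X`. -/
def IsSubcomplexOf (Y X : SComplex V) : Prop := Y.faces ⊆ X.faces

/-- `Y` is a full subcomplex of `X`. -/
def IsFullSubcomplexOf (Y X : SComplex V) : Prop :=
  Y.faces ⊆ X.faces ∧
    ∀ σ ∈ X.faces, (∀ v ∈ σ, ({v} : Finset V) ∈ Y.faces) → σ ∈ Y.faces

/-- The full subcomplex of `X` spanned by a set `W` of vertices. -/
def restrict (X : SComplex V) (W : Set V) : SComplex V where
  faces := {σ | σ ∈ X.faces ∧ ∀ v ∈ σ, v ∈ W}
  nonempty_of_mem := fun σ h => X.nonempty_of_mem σ h.1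
  down_closed := fun σ h τ hτ hne =>
    ⟨X.down_closed σ h.1 τ hτ hne, fun v hv => h.2 v (hτ hv)⟩

/-- The link of a simplex `σ` in `X`. -/
def link (X : SComplex V) (σ : Finset V) : SComplex V where
  faces := {τ | τ ∈ X.faces ∧ Disjoint τ σ ∧ τ ∪ σ ∈ X.faces}
  nonempty_of_mem := fun τ h => X.nonempty_of_mem τ h.1
  down_closed := by
    rintro τ ⟨hτ, hdisj, hunion⟩ ρ hρ hne
    refine ⟨X.down_closed τ hτ ρ hρ hne, ?_, ?_⟩
    · exact Finset.disjoint_left.mpr fun a ha hb => Finset.disjoint_left.mp hdisj (hρ ha) hb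
    · exact X.down_closed _ hunion _ (Finset.union_subset_union hρ (subset_refl σ))
        (hne.mono Finset.subset_union_left)

/-- A combinatorial cycle of length `m` in `X` (a subcomplex homeomorphic to a circle):
an injective enumeration of `m` vertices, consecutive ones joined by edges of `X`. -/
def IsCycle (X : SComplex V) (m : ℕ) (γ : ZMod m → V) : Prop :=
  3 ≤ m ∧ Function.Injective γ ∧ ∀ i : ZMod m, ({γ i, γ (i + 1)} : Finset V) ∈ X.faces

/-- The cycle `γ` has a diagonal: an edge of `X` joining two nonconsecutive vertices. -/
def HasDiagonal (X : SComplex V) (m : ℕ) (γ : ZMod m → V) : Prop :=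
  ∃ i j : ZMod m, j ≠ i ∧ j ≠ i + 1 ∧ j ≠ i - 1 ∧ ({γ i, γ j} : Finset V) ∈ X.faces

/-- A simplicial complex is flag if every finite set of vertices pairwise joined
by edges spans a simplex. -/
def Flag (X : SComplex V) : Prop :=
  ∀ A : Finset V, A.Nonempty → (∀ v ∈ A, ({v} : Finset V) ∈ X.faces) →
    (∀ v ∈ A, ∀ w ∈ A, v ≠ w → ({v, w} : Finset V) ∈ X.faces) → A ∈ X.faces

/-- A simplicial complex is `k`-large if it is flag and every cycle of length
`4 ≤ |γ| < k` has a diagonal. -/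
def KLarge (k : ℕ) (X : SComplex V) : Prop :=
  X.Flag ∧ ∀ (m : ℕ) (γ : ZMod m → V), X.IsCycle m γ → 4 ≤ m → m < k → X.HasDiagonal m γ

/-- A simplicial complex is locally `k`-large if all links of its (nonempty) simplices
are `k`-large. -/
def LocallyKLarge (k : ℕ) (X : SComplex V) : Prop :=
  ∀ σ ∈ X.faces, KLarge k (X.link σ)

/-- A systolic complex: connected, simply connected and locally `6`-large. -/
def Systolic (X : SComplex V) : Prop :=
  LocallyKLarge 6 X ∧ ConnectedSpace X.realization ∧ SimplyConnectedSpace X.realization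

/-- A simplicial complex is locally finite if every vertex belongs to finitely
many simplices. -/
def LocallyFinite (X : SComplex V) : Prop :=
  ∀ v : V, {σ ∈ X.faces | v ∈ σ}.Finite

/-- The faces of the closed combinatorial ball of radius `i` around the simplex `σ`:
`B_0 = σ` and `B_{i+1}` is the union of all closed simplices meeting `B_i`. -/
def ballFaces (X : SComplex V) (σ : Finset V) : ℕ → Set (Finset V)
  | 0 => {τ | τ ∈ X.faces ∧ τ ⊆ σ}
  | i + 1 => {ρ | ρ ∈ X.faces ∧ ∃ τ ∈ X.faces, ρ ⊆ τ ∧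
      ∃ v ∈ τ, ({v} : Finset V) ∈ X.ballFaces σ i}

/-- The closed combinatorial ball of radius `i` around `σ`, as a subcomplex. -/
def ball (X : SComplex V) (σ : Finset V) (i : ℕ) : SComplex V where
  faces := X.ballFaces σ i
  nonempty_of_mem := by
    cases i with
    | zero => exact fun τ h => X.nonempty_of_mem τ h.1
    | succ n => exact fun τ h => X.nonempty_of_mem τ h.1
  down_closed := by
    cases i with
    | zero => exact fun τ h ρ hsub hne =>
        ⟨X.down_closed τ h.1 ρ hsub hne, hsub.trans h.2⟩
    | succ n =>
        rintro τ ⟨hτ, μ, hμ, hsub2, v, hv, hball⟩ ρ hsub hne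
        exact ⟨X.down_closed τ hτ ρ hsub hne, μ, hμ, hsub.trans hsub2, v, hv, hball⟩

/-- The faces of the combinatorial sphere of radius `i` around `σ`: the faces of the
ball `B_i` all of whose vertices are at combinatorial distance exactly `i` from `σ`. -/
def sphereFaces (X : SComplex V) (σ : Finset V) : ℕ → Set (Finset V)
  | 0 => X.ballFaces σ 0
  | i + 1 => {τ | τ ∈ X.ballFaces σ (i + 1) ∧
      ∀ v ∈ τ, ({v} : Finset V) ∉ X.ballFaces σ i}

/-- The combinatorial sphere of radius `i` around `σ`, as a subcomplex: the subcomplex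
of `B_i` spanned by the vertices at combinatorial distance `i` from `σ`. -/
def sphere (X : SComplex V) (σ : Finset V) (i : ℕ) : SComplex V where
  faces := X.sphereFaces σ i
  nonempty_of_mem := by
    cases i with
    | zero => exact fun τ h => (X.ball σ 0).nonempty_of_mem τ h
    | succ n => exact fun τ h => (X.ball σ (n + 1)).nonempty_of_mem τ h.1
  down_closed := by
    cases i with
    | zero => exact fun τ h ρ hsub hne => (X.ball σ 0).down_closed τ h ρ hsub hne
    | succ n =>
        rintro τ ⟨hτ, hout⟩ ρ hsub hne
        exact ⟨(X.ball σ (n + 1)).down_closed τ hτ ρ hsub hne,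
          fun v hv => hout v (hsub hv)⟩

/-- The condition `R(v,X)`: for every simplex `σ` of the link `X_v`, the complement
in `X_v` of the open combinatorial ball of radius `2` around `σ` (i.e. the full
subcomplex of `X_v` spanned by the vertices at combinatorial distance at least `2`
from `σ`) is connected. -/
def CondR (X : SComplex V) (v : V) : Prop :=
  ∀ σ ∈ (X.link {v}).faces,
    ConnectedSpace
      ((X.link {v}).restrict
        {w | ({w} : Finset V) ∉ (X.link {v}).ballFaces σ 1}).realization

/-- A chamber complex of dimension `n`: every simplex is contained in a simplex with
`n+1` vertices (a chamber), there are no larger simplices, and every codimension-one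
face lies in at least two chambers. -/
def IsChamberComplex (X : SComplex V) (n : ℕ) : Prop :=
  (∀ σ ∈ X.faces, σ.card ≤ n + 1) ∧
  (∀ σ ∈ X.faces, ∃ τ ∈ X.faces, σ ⊆ τ ∧ τ.card = n + 1) ∧
  (∀ σ ∈ X.faces, σ.card = n →
    ∃ τ₁ ∈ X.faces, ∃ τ₂ ∈ X.faces, τ₁ ≠ τ₂ ∧ σ ⊆ τ₁ ∧ σ ⊆ τ₂ ∧
      τ₁.card = n + 1 ∧ τ₂.card = n + 1)

/-- Two chambers of an `n`-dimensional chamber complex are adjacent if they share a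
codimension-one face. -/
def ChamberAdj (X : SComplex V) (n : ℕ) (σ τ : Finset V) : Prop :=
  σ ∈ X.faces ∧ τ ∈ X.faces ∧ σ.card = n + 1 ∧ τ.card = n + 1 ∧
    ∃ ρ ∈ X.faces, ρ.card = n ∧ ρ ⊆ σ ∧ ρ ⊆ τ

/-- A chamber complex is gallery connected if any two chambers are joined by a gallery. -/
def GalleryConnected (X : SComplex V) (n : ℕ) : Prop :=
  ∀ σ ∈ X.faces, σ.card = n + 1 → ∀ τ ∈ X.faces, τ.card = n + 1 →
    Relation.ReflTransGen (X.ChamberAdj n) σ τ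

/-- A normal chamber complex: gallery connected, with all links of dimension above `0`
gallery connected. -/
def IsNormalChamberComplex (X : SComplex V) (n : ℕ) : Prop :=
  IsChamberComplex X n ∧ GalleryConnected X n ∧
    ∀ σ ∈ X.faces, σ.card ≤ n - 1 → GalleryConnected (X.link σ) (n - σ.card)

/-- A pseudomanifold of dimension `n`: a chamber complex in which every codimension-one
face belongs to exactly two chambers. -/
def IsPseudomanifold (X : SComplex V) (n : ℕ) : Prop :=
  IsChamberComplex X n ∧
    ∀ σ ∈ X.faces, σ.card = n →
      ({τ | τ ∈ X.faces ∧ σ ⊆ τ ∧ τ.card = n + 1} : Set (Finset V)).ncard = 2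

/-- The dimension of a (finite-dimensional) simplicial complex. -/
noncomputable def dim (X : SComplex V) : ℕ := sSup {n : ℕ | ∃ σ ∈ X.faces, σ.card = n + 1}

/-- A simplicial complex is finite dimensional. -/
def IsFiniteDimensional (X : SComplex V) : Prop :=
  ∃ N : ℕ, ∀ σ ∈ X.faces, σ.card ≤ N + 1

end SComplex
/-- The condition `Conn_n^∞(Y)`: for every compact `K ⊆ Y` there is a compact
`L ⊇ K` such that every map of the `n`-sphere into `Y ∖ L` extends to a map of the
`(n+1)`-ball into `Y ∖ K`. -/
def ConnInfty (Y : Type u) [TopologicalSpace Y] (n : ℤ) : Prop :=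
  ∀ K : Set Y, IsCompact K → ∃ L : Set Y, IsCompact L ∧ K ⊆ L ∧
    ∀ f : EuclideanSpace ℝ (Fin (n + 1).toNat) → Y,
      ContinuousOn f (Metric.sphere 0 1) →
      (∀ x ∈ Metric.sphere (0 : EuclideanSpace ℝ (Fin (n + 1).toNat)) 1, f x ∉ L) →
      ∃ g : EuclideanSpace ℝ (Fin (n + 1).toNat) → Y,
        ContinuousOn g (Metric.closedBall 0 1) ∧
        (∀ x ∈ Metric.closedBall (0 : EuclideanSpace ℝ (Fin (n + 1).toNat)) 1, g x ∉ K) ∧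
        ∀ x ∈ Metric.sphere (0 : EuclideanSpace ℝ (Fin (n + 1).toNat)) 1, g x = f x

/-- A space is `n`-connected at infinity if `Conn_k^∞` holds for all `-1 ≤ k ≤ n`. -/
def ConnectedAtInftyUpTo (Y : Type u) [TopologicalSpace Y] (n : ℤ) : Prop :=
  ∀ k : ℤ, -1 ≤ k → k ≤ n → ConnInfty Y k

/-- A CW structure on a topological space `X`: cells in each dimension with
characteristic maps defined on closed unit balls, such that the open cells partition
`X`, attaching spheres land in lower-dimensional cells, each closed cell meets only
finitely many open cells, and `X` carries the weak topology. -/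
structure CWStructure (X : Type u) [TopologicalSpace X] where
  cell : ℕ → Type
  attach : (n : ℕ) → cell n → (EuclideanSpace ℝ (Fin n) → X)
  continuousOn_attach : ∀ n i, ContinuousOn (attach n i) (Metric.closedBall 0 1)
  injOn_attach : ∀ n i, Set.InjOn (attach n i) (Metric.ball 0 1)
  pairwiseDisjoint :
    Set.univ.PairwiseDisjoint
      (fun p : Σ n, cell n => attach p.1 p.2 '' Metric.ball 0 1)
  cover : (⋃ p : Σ n, cell n, attach p.1 p.2 '' Metric.ball 0 1) = Set.univ
  attach_sphere : ∀ n i, attach n i '' Metric.sphere 0 1 ⊆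
    ⋃ (p : Σ m, cell m) (_ : p.1 < n), attach p.1 p.2 '' Metric.ball 0 1
  closure_finiteness : ∀ n i,
    {p : Σ m, cell m | (attach p.1 p.2 '' Metric.ball 0 1) ∩
      (attach n i '' Metric.closedBall 0 1) ≠ ∅}.Finite
  weak_topology : ∀ A : Set X,
    (∀ n i, IsClosed {x : EuclideanSpace ℝ (Fin n) |
      x ∈ Metric.closedBall 0 1 ∧ attach n i x ∈ A}) → IsClosed A

/-- The open cell of a CW structure. -/
def CWStructure.openCell {X : Type u} [TopologicalSpace X] (cw : CWStructure X)
    (n : ℕ) (i : cw.cell n) : Set X :=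
  cw.attach n i '' Metric.ball 0 1

/-- A rigid cellular action of a group on a CW complex: the action is by
homeomorphisms permuting the open cells, and any element stabilizing a cell fixes it
pointwise. -/
def IsRigidCellularAction (G : Type) [Group G] {X : Type u} [TopologicalSpace X]
    [MulAction G X] (cw : CWStructure X) : Prop :=
  (∀ g : G, Continuous fun x : X => g • x) ∧
  (∀ (g : G) (n : ℕ) (i : cw.cell n), ∃ j : cw.cell n,
    (fun x => g • x) '' cw.openCell n i = cw.openCell n j) ∧
  (∀ (g : G) (n : ℕ) (i : cw.cell n),
    (fun x => g • x) '' cw.openCell n i = cw.openCell n i →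
      ∀ x ∈ cw.openCell n i, g • x = x)

/-- A group action on a topological space is cocompact. -/
def IsCocompactAction (G : Type) (X : Type u) [Group G] [TopologicalSpace X]
    [MulAction G X] : Prop :=
  ∃ K : Set X, IsCompact K ∧ (⋃ g : G, (fun x => g • x) '' K) = Set.univ

/-- The condition `Conn_n^∞(G)` for a group `G`: `Conn_n^∞(X)` holds for every
contractible rigid `G`-CW complex `X` on which `G` acts properly discontinuously and
cocompactly. -/
def ConnInftyGroup (G : Type) [Group G] (n : ℤ) : Prop :=
  ∀ (X : Type) [TopologicalSpace X] [MulAction G X],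
    ContractibleSpace X →
    (∃ cw : CWStructure X, IsRigidCellularAction G cw) →
    ProperlyDiscontinuousSMul G X →
    IsCocompactAction G X →
    ConnInfty X n

namespace SComplex

variable {V : Type u} [DecidableEq V]

/-- A group action on the vertices is simplicial if it maps faces to faces. -/
def IsSimplicialAction (G : Type) [Group G] [MulAction G V] (X : SComplex V) : Prop :=
  ∀ (g : G), ∀ σ ∈ X.faces, σ.image (fun v => g • v) ∈ X.faces

/-- A simplicial action is properly discontinuous: all simplex stabilizers are finite. -/
def HasFiniteStabilizers (G : Type) [Group G] [MulAction G V] (X : SComplex V) : Prop :=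
  ∀ σ ∈ X.faces, {g : G | σ.image (fun v => g • v) = σ}.Finite

/-- A simplicial action is cocompact: there are finitely many orbits of simplices. -/
def IsCocompactSAction (G : Type) [Group G] [MulAction G V] (X : SComplex V) : Prop :=
  ∃ S : Set (Finset V), S.Finite ∧
    ∀ τ ∈ X.faces, ∃ σ ∈ S, ∃ g : G, τ = σ.image (fun v => g • v)

end SComplex

/-- A systolic group: a group admitting a properly discontinuous cocompact action by
simplicial automorphisms on a systolic complex. -/
def IsSystolicGroup (G : Type) [Group G] : Prop :=
  ∃ (V : Type) (_ : DecidableEq V) (X : SComplex V) (_ : MulAction G V),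
    X.Systolic ∧ X.IsSimplicialAction G ∧ X.HasFiniteStabilizers G ∧
      X.IsCocompactSAction G
/-- The free `kG`-module `⊕_ι kG`, as a representation of `G` over `k`: the
permutation representation on `ι × G` where `G` acts by left translation on the
second factor. -/
noncomputable def freeRep (k : Type) [CommRing k] (G : Type) [Group G] (ι : Type) :
    Rep k G :=
  letI : MulAction G (ι × G) :=
    { smul := fun g p => (p.1, g * p.2)
      one_smul := fun p => by show (p.1, 1 * p.2) = p; simp
      mul_smul := fun g h p => by
        show (p.1, g * h * p.2) = (p.1, g * (h * p.2)); rw [mul_assoc] }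
  Rep.of (Representation.ofMulAction k G (ι × G))

namespace ListChain

variable {R : Type*} [CommRing R] {P Q : Type*}

/-- Two linear conditions agree on `Finsupp.supported` as soon as they agree on basis vectors. -/
theorem map_mem_of_mem_supported {α M : Type*} [AddCommGroup M] [Module R M] {S : Set α}
    {W : Submodule R M} (F : (α →₀ R) →ₗ[R] M) (h : ∀ a ∈ S, F (Finsupp.single a 1) ∈ W)
    {c : α →₀ R} (hc : c ∈ Finsupp.supported R R S) : F c ∈ W := by
  rw [Finsupp.supported_eq_span_single] at hc
  have : Submodule.span R ((fun i => Finsupp.single i (1 : R)) '' S) ≤ W.comap F := by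
    rw [Submodule.span_le]
    rintro _ ⟨a, ha, rfl⟩
    exact h a ha
  exact this hc

theorem map_eq_of_mem_supported {α M : Type*} [AddCommGroup M] [Module R M] {S : Set α}
    (F F' : (α →₀ R) →ₗ[R] M)
    (h : ∀ a ∈ S, F (Finsupp.single a 1) = F' (Finsupp.single a 1))
    {c : α →₀ R} (hc : c ∈ Finsupp.supported R R S) : F c = F' c := by
  have := map_mem_of_mem_supported (W := ⊥) (F - F')
    (fun a ha => by simp [h a ha]) hc
  simpa [sub_eq_zero] using this

/-- The cone operator on chains of lists: prepend the point `p`. -/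
noncomputable def cone (p : P) : (List P →₀ R) →ₗ[R] (List P →₀ R) :=
  Finsupp.lmapDomain R R (List.cons p)

@[simp] theorem cone_single (p : P) (l : List P) (r : R) :
    cone p (Finsupp.single l r) = Finsupp.single (p :: l) r := by
  simp [cone]

/-- The alternating sum of the faces of a list. -/
noncomputable def bdryList : List P → (List P →₀ R)
  | [] => 0
  | p :: l => Finsupp.single l 1 - cone p (bdryList l)

/-- The boundary operator of the augmented ordered chain complex (graded by length). -/
noncomputable def bdry : (List P →₀ R) →ₗ[R] (List P →₀ R) :=
  Finsupp.linearCombination R bdryList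

@[simp] theorem bdry_nil : bdry (Finsupp.single ([] : List P) (1 : R)) = 0 := by
  simp [bdry, bdryList]

@[simp] theorem bdry_cons (p : P) (l : List P) :
    bdry (Finsupp.single (p :: l) (1 : R)) =
      Finsupp.single l 1 - cone p (bdry (Finsupp.single l 1)) := by
  simp [bdry, bdryList]

theorem bdry_cone (p : P) (c : List P →₀ R) : bdry (cone p c) = c - cone p (bdry c) := by
  have : bdry ∘ₗ cone p = LinearMap.id - (cone p ∘ₗ bdry : (List P →₀ R) →ₗ[R] _) := by
    ext l : 2
    simp
  exact LinearMap.congr_fun this c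

theorem bdry_bdry (c : List P →₀ R) : bdry (bdry c) = 0 := by
  have : bdry ∘ₗ bdry = (0 : (List P →₀ R) →ₗ[R] _) := by
    ext l : 2
    induction l with
    | nil => simp
    | cons p l ih =>
      simp only [LinearMap.comp_apply, Finsupp.lsingle_apply, LinearMap.zero_apply] at ih ⊢
      rw [bdry_cons, map_sub, bdry_cone, ih]
      simp
  exact LinearMap.congr_fun this c

theorem bdry_mem (l : List P) : bdry (Finsupp.single l (1 : R)) ∈
    Finsupp.supported R R {l' | l'.Sublist l ∧ l'.length + 1 = l.length} := by
  induction l with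
  | nil => simp
  | cons p l ih =>
    rw [bdry_cons]
    refine Submodule.sub_mem _ (Finsupp.single_mem_supported _ _ (by simp)) ?_
    refine map_mem_of_mem_supported (cone p) ?_ ih
    rintro a ⟨ha, ha'⟩
    rw [cone_single]
    exact Finsupp.single_mem_supported _ _ (by simp [ha, ha'])

/-- The chain map induced by a map of vertices. -/
noncomputable def push (f : P → Q) : (List P →₀ R) →ₗ[R] (List Q →₀ R) :=
  Finsupp.lmapDomain R R (List.map f)

@[simp] theorem push_single (f : P → Q) (l : List P) (r : R) :
    push f (Finsupp.single l r) = Finsupp.single (l.map f) r := by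
  simp [push]

theorem push_cone (f : P → Q) (p : P) (c : List P →₀ R) :
    push f (cone p c) = cone (f p) (push f c) := by
  have : push f ∘ₗ cone p = (cone (f p) ∘ₗ push f : (List P →₀ R) →ₗ[R] _) := by
    ext l : 2
    simp
  exact LinearMap.congr_fun this c

theorem bdry_push (f : P → Q) (c : List P →₀ R) : bdry (push f c) = push f (bdry c) := by
  have : bdry ∘ₗ push f = (push f ∘ₗ bdry : (List P →₀ R) →ₗ[R] _) := by
    ext l : 2
    induction l with
    | nil => simp
    | cons p l ih =>
      simp only [LinearMap.comp_apply, Finsupp.lsingle_apply, push_single] at ih ⊢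
      simp [ih, push_cone]
  exact LinearMap.congr_fun this c

/-- The prism on a list, interpolating between two vertex maps. -/
noncomputable def prismList (f g : P → Q) : List P → (List Q →₀ R)
  | [] => 0
  | p :: l => Finsupp.single (f p :: g p :: l.map g) 1 - cone (f p) (prismList f g l)

/-- The prism operator. -/
noncomputable def prism (f g : P → Q) : (List P →₀ R) →ₗ[R] (List Q →₀ R) :=
  Finsupp.linearCombination R (prismList f g)

@[simp] theorem prism_nil (f g : P → Q) : prism f g (Finsupp.single [] (1 : R)) = 0 := by
  simp [prism, prismList]

@[simp] theorem prism_cons (f g : P → Q) (p : P) (l : List P) :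
    prism f g (Finsupp.single (p :: l) (1 : R)) =
      Finsupp.single (f p :: g p :: l.map g) 1 - cone (f p) (prism f g (Finsupp.single l 1)) := by
  simp [prism, prismList]

theorem prism_cone (f g : P → Q) (p : P) (c : List P →₀ R) :
    prism f g (cone p c) = cone (f p) (cone (g p) (push g c)) - cone (f p) (prism f g c) := by
  have : prism f g ∘ₗ cone p = (cone (f p) ∘ₗ cone (g p) ∘ₗ push g -
      cone (f p) ∘ₗ prism f g : (List P →₀ R) →ₗ[R] _) := by
    ext l : 2
    simp
  exact LinearMap.congr_fun this c

theorem bdry_prism (f g : P → Q) (c : List P →₀ R) :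
    bdry (prism f g c) + prism f g (bdry c) = push g c - push f c := by
  have : bdry ∘ₗ prism f g + prism f g ∘ₗ bdry =
      (push g - push f : (List P →₀ R) →ₗ[R] _) := by
    ext l : 2
    induction l with
    | nil => simp
    | cons p l ih =>
      simp only [LinearMap.comp_apply, Finsupp.lsingle_apply, LinearMap.add_apply,
        LinearMap.sub_apply] at ih ⊢
      have h : push g (bdry (Finsupp.single l (1 : R))) = bdry (Finsupp.single (l.map g) 1) := by
        rw [← bdry_push, push_single]
      have ih' := congrArg (cone (f p)) ih
      simp only [map_add, map_sub, push_single, cone_single] at ih'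
      simp only [prism_cons, map_sub, bdry_cons, bdry_cone, prism_cone, push_single, h,
        List.map_cons, cone_single] at ih' ⊢
      rw [← sub_eq_zero] at ih' ⊢
      rw [← ih']
      abel
  exact LinearMap.congr_fun this c

theorem prism_mem (f g : P → Q) (l : List P) : prism f g (Finsupp.single l (1 : R)) ∈
    Finsupp.supported R R {l' | ∀ x ∈ l', x ∈ l.map f ∨ x ∈ l.map g} := by
  induction l with
  | nil => simp
  | cons p l ih =>
    rw [prism_cons]
    refine Submodule.sub_mem _ (Finsupp.single_mem_supported _ _ ?_) ?_
    · simp +contextual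
    refine map_mem_of_mem_supported (cone (f p)) ?_ ih
    intro a ha
    rw [cone_single]
    refine Finsupp.single_mem_supported _ _ ?_
    intro x hx
    rcases List.mem_cons.1 hx with rfl | hx
    · simp
    · rcases ha x hx with h | h
      · exact Or.inl (List.mem_cons_of_mem _ h)
      · exact Or.inr (List.mem_cons_of_mem _ h)

/-- A chain of contiguous vertex maps ending in a constant map kills cycles. -/
theorem exists_bdry_eq_push_of_contiguous {S : Set (List P)} {T : Set (List Q)} (N : ℕ)
    (f : ℕ → P → Q) (q : Q)
    (hcont : ∀ l ∈ S, ∀ i < N, ∀ l' : List Q,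
      (∀ x ∈ l', x ∈ l.map (f i) ∨ x ∈ l.map (f (i + 1))) → l' ∈ T)
    (hconst : ∀ l ∈ S, ∀ x ∈ l, f N x = q) (hq : ∀ l' : List Q, (∀ x ∈ l', x = q) → l' ∈ T)
    {c : List P →₀ R} (hc : c ∈ Finsupp.supported R R S) (hd : bdry c = 0) :
    ∃ b ∈ Finsupp.supported R R T, bdry b = push (f 0) c := by
  induction N generalizing f with
  | zero =>
    refine ⟨cone q (push (f 0) c), ?_, by rw [bdry_cone, bdry_push, hd]; simp⟩
    refine map_mem_of_mem_supported (cone q ∘ₗ push (f 0)) ?_ hc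
    intro l hl
    simp only [LinearMap.comp_apply, push_single, cone_single]
    refine Finsupp.single_mem_supported _ _ (hq _ ?_)
    intro x hx
    rcases List.mem_cons.1 hx with rfl | hx
    · rfl
    · obtain ⟨y, hy, rfl⟩ := List.mem_map.1 hx
      exact hconst l hl y hy
  | succ N ih =>
    obtain ⟨b, hb, hbd⟩ := ih (fun i => f (i + 1))
      (fun l hl i hi => hcont l hl (i + 1) (by omega)) hconst
    refine ⟨b - prism (f 0) (f 1) c, Submodule.sub_mem _ hb ?_, ?_⟩
    · refine map_mem_of_mem_supported (prism (f 0) (f 1)) ?_ hc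
      intro l hl
      exact Finsupp.supported_mono (hcont l hl 0 (by omega)) (prism_mem _ _ l)
    · have := bdry_prism (f 0) (f 1) c
      rw [hd, map_zero, add_zero] at this
      rw [map_sub, hbd, this]
      abel

/-- A chain map carried by faces and vanishing on the augmentation sends cycles to boundaries. -/
theorem exists_bdry_eq_of_carried {T : Set (List P)}
    (hT : ∀ l ∈ T, ∀ l' : List P, l' ⊆ l → l' ∈ T)
    (F : (List P →₀ R) →ₗ[R] (List P →₀ R)) (hF : ∀ l ∈ T,
      bdry (F (Finsupp.single l 1)) = F (bdry (Finsupp.single l 1)))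
    (hnil : F (Finsupp.single [] 1) = 0)
    (hcar : ∀ l ∈ T, F (Finsupp.single l 1) ∈ Finsupp.supported R R {l' | l' ⊆ l})
    {c : List P →₀ R} (hc : c ∈ Finsupp.supported R R T) (hd : bdry c = 0) :
    ∃ b ∈ Finsupp.supported R R T, bdry b = F c := by
  have key : ∃ h : List P → (List P →₀ R), ∀ l ∈ T,
      h l ∈ Finsupp.supported R R {l' | l' ⊆ l} ∧
      bdry (h l) + Finsupp.linearCombination R h (bdry (Finsupp.single l 1)) =
        F (Finsupp.single l 1) := by
    let hn : ℕ → List P → (List P →₀ R) := fun n => Nat.rec (fun _ => 0) (fun n hn l =>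
      match l with
      | [] => 0
      | p :: l => cone p (F (Finsupp.single (p :: l) 1) -
          Finsupp.linearCombination R hn (bdry (Finsupp.single (p :: l) 1)))) n
    have hlc : ∀ (n : ℕ) (l : List P), l.length = n + 1 →
        Finsupp.linearCombination R (fun l => hn l.length l) (bdry (Finsupp.single l 1)) =
          Finsupp.linearCombination R (hn n) (bdry (Finsupp.single l 1)) := by
      intro n l hl
      refine map_eq_of_mem_supported _ _ ?_ (bdry_mem l)
      rintro a ⟨-, ha⟩
      have : a.length = n := by omega
      simp [this]
    have hmain : ∀ (n : ℕ) (l : List P), l.length = n → l ∈ T →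
        hn n l ∈ Finsupp.supported R R {l' | l' ⊆ l} ∧
        bdry (hn n l) + Finsupp.linearCombination R (fun l => hn l.length l)
          (bdry (Finsupp.single l 1)) = F (Finsupp.single l 1) := by
      intro n
      induction n with
      | zero =>
        intro l hl hlT
        obtain rfl := List.length_eq_zero_iff.1 hl
        simp [hn, hnil]
      | succ n ih =>
        intro l hl hlT
        have hl' := hlc n l hl
        obtain _ | ⟨p, l⟩ := l
        · simp at hl
        have hsub : ∀ a ∈ {l' | l'.Sublist (p :: l) ∧ l'.length + 1 = (p :: l).length}, a ∈ T :=
          fun a ha => hT _ hlT _ ha.1.subset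
        have e : hn (n + 1) (p :: l) = cone p (F (Finsupp.single (p :: l) 1) -
          Finsupp.linearCombination R (hn n) (bdry (Finsupp.single (p :: l) 1))) := rfl
        have hx : bdry (Finsupp.linearCombination R (hn n) (bdry (Finsupp.single (p :: l) 1)))
            = F (bdry (Finsupp.single (p :: l) 1)) := by
          have h1 := map_eq_of_mem_supported
            (bdry ∘ₗ Finsupp.linearCombination R (hn n) +
              Finsupp.linearCombination R (fun l => hn l.length l) ∘ₗ bdry) F
            (S := {l' | l'.Sublist (p :: l) ∧ l'.length + 1 = (p :: l).length}) ?_ (bdry_mem _)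
          · simpa only [LinearMap.add_apply, LinearMap.comp_apply, bdry_bdry, map_zero,
              add_zero] using h1
          · rintro a ha
            have := (ih a (by have := ha.2; omega) (hsub a ha)).2
            simpa using this
        refine ⟨?_, ?_⟩
        · rw [e]
          have : F (Finsupp.single (p :: l) 1) - Finsupp.linearCombination R (hn n)
              (bdry (Finsupp.single (p :: l) 1)) ∈
              Finsupp.supported R R {l' | l' ⊆ p :: l} := by
            refine Submodule.sub_mem _ (hcar _ hlT) ?_
            refine map_mem_of_mem_supported _ ?_ (bdry_mem _)
            intro a ha
            rw [Finsupp.linearCombination_single, one_smul]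
            exact Finsupp.supported_mono (fun b (hb : b ⊆ a) => List.Subset.trans hb ha.1.subset)
              (ih a (by have := ha.2; omega) (hsub a ha)).1
          refine map_mem_of_mem_supported (cone p) ?_ this
          intro a ha
          rw [cone_single]
          refine Finsupp.single_mem_supported _ _ ?_
          simpa using ha
        · rw [hl', e, bdry_cone, map_sub (bdry (R := R) (P := P)), hx, hF _ hlT]
          simp
    exact ⟨fun l => hn l.length l, fun l hl => hmain _ l rfl hl⟩
  obtain ⟨h, hh⟩ := key
  refine ⟨Finsupp.linearCombination R h c, ?_, ?_⟩
  · refine map_mem_of_mem_supported _ ?_ hc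
    intro a ha
    rw [Finsupp.linearCombination_single, one_smul]
    exact Finsupp.supported_mono (hT a ha) (hh a ha).1
  · have := map_eq_of_mem_supported
      (bdry ∘ₗ Finsupp.linearCombination R h + Finsupp.linearCombination R h ∘ₗ bdry) F
      (fun a ha => by simpa using (hh a ha).2) hc
    simpa [hd] using this

/-- Construction of a chain map along an acyclic carrier. -/
theorem exists_chainMap_of_acyclic {T : Set (List P)}
    (hT : ∀ l ∈ T, ∀ l' : List P, l' ⊆ l → l' ∈ T) (C : List P → Set (List Q))
    (hC : ∀ l l', l' ⊆ l → C l' ⊆ C l) (hCnil : [] ∈ C [])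
    (hacyc : ∀ l ∈ T, l ≠ [] → ∀ c ∈ Finsupp.supported R R (C l), bdry c = 0 →
      ∃ b ∈ Finsupp.supported R R (C l), bdry b = c) :
    ∃ s : (List P →₀ R) →ₗ[R] (List Q →₀ R), s (Finsupp.single [] 1) = Finsupp.single [] 1 ∧
      ∀ l ∈ T, s (Finsupp.single l 1) ∈ Finsupp.supported R R (C l) ∧
        bdry (s (Finsupp.single l 1)) = s (bdry (Finsupp.single l 1)) := by
  classical
  let fill : List P → (List Q →₀ R) → (List Q →₀ R) := fun l c =>
    if h : ∃ b ∈ Finsupp.supported R R (C l), bdry b = c then h.choose else 0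
  have hfill : ∀ l c, (∃ b ∈ Finsupp.supported R R (C l), bdry b = c) →
      fill l c ∈ Finsupp.supported R R (C l) ∧ bdry (fill l c) = c := by
    intro l c h
    simp only [fill, dif_pos h]
    exact h.choose_spec
  let sn : ℕ → List P → (List Q →₀ R) := fun n => Nat.rec (fun _ => Finsupp.single [] 1)
    (fun n sn l => fill l (Finsupp.linearCombination R sn (bdry (Finsupp.single l 1)))) n
  have hlc : ∀ (n : ℕ) (l : List P), l.length = n + 1 →
      Finsupp.linearCombination R (fun l => sn l.length l) (bdry (Finsupp.single l 1)) =
        Finsupp.linearCombination R (sn n) (bdry (Finsupp.single l 1)) := by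
    intro n l hl
    refine map_eq_of_mem_supported _ _ ?_ (bdry_mem l)
    rintro a ⟨-, ha⟩
    have : a.length = n := by omega
    simp [this]
  have hmain : ∀ (n : ℕ) (l : List P), l.length = n → l ∈ T →
      sn n l ∈ Finsupp.supported R R (C l) ∧
        bdry (sn n l) = Finsupp.linearCombination R (fun l => sn l.length l)
          (bdry (Finsupp.single l 1)) := by
    intro n
    induction n with
    | zero =>
      intro l hl _
      obtain rfl := List.length_eq_zero_iff.1 hl
      exact ⟨Finsupp.single_mem_supported _ _ hCnil, by simp [sn]⟩
    | succ n ih =>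
      intro l hl hlT
      rw [hlc n l hl]
      refine hfill _ _ (hacyc l hlT (by rintro rfl; simp at hl) _ ?_ ?_)
      · refine map_mem_of_mem_supported _ ?_ (bdry_mem l)
        rintro a ha
        rw [Finsupp.linearCombination_single, one_smul]
        exact Finsupp.supported_mono (hC _ _ ha.1.subset)
          (ih a (by have := ha.2; omega) (hT _ hlT _ ha.1.subset)).1
      · have h1 := map_eq_of_mem_supported
          (bdry ∘ₗ Finsupp.linearCombination R (sn n))
          (Finsupp.linearCombination R (fun l => sn l.length l) ∘ₗ bdry)
          (S := {l' | l'.Sublist l ∧ l'.length + 1 = l.length}) ?_ (bdry_mem _)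
        · simpa only [LinearMap.comp_apply, bdry_bdry, map_zero] using h1
        · intro a ha
          simpa using (ih a (by have := ha.2; omega) (hT _ hlT _ ha.1.subset)).2
  refine ⟨Finsupp.linearCombination R (fun l => sn l.length l), by simp [sn], fun l hl => ?_⟩
  rw [Finsupp.linearCombination_single, one_smul]
  exact hmain _ l rfl hl

/-- The Vietoris-Rips complex of a bounded convex set is acyclic at every scale. -/
theorem exists_bdry_eq_of_convex {R : Type*} [CommRing R] {E : Type*} [NormedAddCommGroup E]
    [NormedSpace ℝ E] {D : Set E} (hD : Convex ℝ D) (hne : D.Nonempty) {M : ℝ}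
    (hM : ∀ x ∈ D, ∀ y ∈ D, dist x y ≤ M) {ε : ℝ} (hε : 0 < ε) {c : List E →₀ R}
    (hc : c ∈ Finsupp.supported R R {l : List E | ∀ x ∈ l, x ∈ D ∧ ∀ y ∈ l, dist x y < ε})
    (hd : bdry c = 0) :
    ∃ b ∈ Finsupp.supported R R {l : List E | ∀ x ∈ l, x ∈ D ∧ ∀ y ∈ l, dist x y < ε},
      bdry b = c := by
  classical
  obtain ⟨p, hp⟩ := hne
  have hcs := (Finsupp.mem_supported _ _).1 hc
  obtain ⟨ε', hε', hcε⟩ : ∃ ε' < ε, ∀ l ∈ c.support, ∀ x ∈ l.toFinset, ∀ y ∈ l.toFinset,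
      dist x y ≤ ε' := by
    have h : ∀ᶠ ε' in nhdsWithin ε (Set.Iio ε), ∀ l ∈ c.support, ∀ x ∈ l.toFinset,
        ∀ y ∈ l.toFinset, dist x y ≤ ε' := by
      refine (Filter.eventually_all_finset _).2 fun l hl =>
        (Filter.eventually_all_finset _).2 fun x hx =>
        (Filter.eventually_all_finset _).2 fun y hy => ?_
      have : dist x y < ε :=
        (hcs (by exact hl) x (List.mem_toFinset.1 hx)).2 y (List.mem_toFinset.1 hy)
      exact (eventually_ge_nhds this).filter_mono nhdsWithin_le_nhds
    obtain ⟨e, he, he'⟩ := (h.and self_mem_nhdsWithin).exists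
    exact ⟨e, he', he⟩
  obtain ⟨N, hN⟩ := exists_nat_gt (M / (ε - ε'))
  have hM0 : 0 ≤ M := dist_nonneg.trans (hM p hp p hp)
  have hN0 : (0 : ℝ) < N := lt_of_le_of_lt (div_nonneg hM0 (by linarith)) hN
  have hN' : ε' + (1 / N) * M < ε := by
    rw [div_lt_iff₀ (by linarith)] at hN
    have : M / N < ε - ε' := by rw [div_lt_iff₀ hN0]; linarith
    rw [one_div_mul_eq_div]
    linarith
  have hpush : push (fun x => AffineMap.lineMap x p (((0 : ℕ) : ℝ) / N)) c = c := by
    have : (fun x => AffineMap.lineMap x p (((0 : ℕ) : ℝ) / N)) = (id : E → E) := by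
      ext x; simp
    rw [this, push, List.map_id_fun]
    simp
  rw [← hpush]
  refine exists_bdry_eq_push_of_contiguous
    (S := {l : List E | ∀ x ∈ l, x ∈ D ∧ ∀ y ∈ l, dist x y ≤ ε'}) N
    (fun i x => AffineMap.lineMap x p ((i : ℝ) / N)) p ?_ ?_ ?_ ?_ hd
  · intro l hl i hi l' hl'
    have hi1 : ((i : ℝ) + 1) / N ≤ 1 := by
      rw [div_le_one hN0]; exact_mod_cast hi
    have hi0 : (0 : ℝ) ≤ (i : ℝ) / N := by positivity
    have hi2 : (i : ℝ) / N + 1 / N = ((i : ℝ) + 1) / N := by ring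
    have hN1 : (0 : ℝ) ≤ 1 / N := by positivity
    have hrep : ∀ x ∈ l', ∃ y ∈ l, ∃ t : ℝ, (i : ℝ) / N ≤ t ∧ t ≤ (i : ℝ) / N + 1 / N ∧
        x = AffineMap.lineMap y p t := by
      intro x hx
      rcases hl' x hx with h | h
      · obtain ⟨y, hy, rfl⟩ := List.mem_map.1 h
        exact ⟨y, hy, _, le_rfl, by linarith, rfl⟩
      · obtain ⟨y, hy, rfl⟩ := List.mem_map.1 h
        refine ⟨y, hy, _, ?_, ?_, rfl⟩
        · push_cast; linarith
        · push_cast; linarith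
    intro x hx
    obtain ⟨x', hx', s, hs, hs', rfl⟩ := hrep x hx
    refine ⟨hD.lineMap_mem (hl x' hx').1 hp ⟨by linarith, by linarith⟩, ?_⟩
    intro y hy
    obtain ⟨y', hy', t, ht, ht', rfl⟩ := hrep y hy
    have e1 : dist (AffineMap.lineMap x' p s) (AffineMap.lineMap y' p s : E) ≤ ε' := by
      have : (AffineMap.lineMap x' p s : E) - AffineMap.lineMap y' p s = (1 - s) • (x' - y') := by
        simp only [AffineMap.lineMap_apply_module]
        module
      rw [dist_eq_norm, this, norm_smul, Real.norm_eq_abs, abs_of_nonneg (by linarith),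
        ← dist_eq_norm]
      have := (hl x' hx').2 y' hy'
      have h0 : 0 ≤ dist x' y' := dist_nonneg
      nlinarith
    have e2 : dist (AffineMap.lineMap y' p s) (AffineMap.lineMap y' p t : E) ≤ 1 / N * M := by
      rw [dist_lineMap_lineMap]
      refine mul_le_mul ?_ (hM _ (hl y' hy').1 _ hp) dist_nonneg hN1
      rw [Real.dist_eq, abs_le]
      constructor <;> linarith
    calc _ ≤ _ := dist_triangle _ (AffineMap.lineMap y' p s) _
      _ < ε := by linarith
  · intro l _ x _
    simp [div_self hN0.ne']
  · intro l' hl' x hx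
    rw [hl' x hx]
    exact ⟨hp, fun y hy => by rw [hl' y hy]; simpa using hε⟩
  · rw [Finsupp.mem_supported]
    intro l hl x hx
    exact ⟨(hcs hl x hx).1, fun y hy =>
      hcε l hl x (List.mem_toFinset.2 hx) y (List.mem_toFinset.2 hy)⟩

end ListChain

namespace SComplex

open ListChain

variable {V : Type*}

/-- Points with coordinates in `F` and support in `A`, in barycentric coordinates. -/
def baryCell (F : Finset V) (A : Set V) : Set (F → ℝ) :=
  {x | (∀ v, 0 ≤ x v) ∧ (∀ v, v.1 ∉ A → x v = 0) ∧ ∑ v, x v = 1}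

theorem convex_baryCell (F : Finset V) (A : Set V) : Convex ℝ (baryCell F A) := by
  intro x hx y hy a b ha hb hab
  refine ⟨fun v => ?_, fun v hv => ?_, ?_⟩
  · have := hx.1 v
    have := hy.1 v
    simp only [Pi.add_apply, Pi.smul_apply, smul_eq_mul]
    positivity
  · simp [hx.2.1 v hv, hy.2.1 v hv]
  · simp only [Pi.add_apply, Pi.smul_apply, smul_eq_mul, Finset.sum_add_distrib, ← Finset.mul_sum,
      hx.2.2, hy.2.2, mul_one, hab]

theorem baryCell_subset (F : Finset V) (A : Set V) :
    baryCell F A ⊆ Set.univ.pi fun _ => Set.Icc 0 1 := by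
  intro x hx v _
  refine ⟨hx.1 v, ?_⟩
  rw [← hx.2.2]
  exact Finset.single_le_sum (fun v _ => hx.1 v) (Finset.mem_univ v)

theorem dist_le_one_of_mem_baryCell {F : Finset V} {A : Set V} {x y : F → ℝ}
    (hx : x ∈ baryCell F A) (hy : y ∈ baryCell F A) : dist x y ≤ 1 := by
  refine (dist_pi_le_iff zero_le_one).2 fun v => ?_
  have h1 := baryCell_subset F A hx v trivial
  have h2 := baryCell_subset F A hy v trivial
  rw [Real.dist_eq, abs_le]
  constructor <;> linarith [h1.1, h1.2, h2.1, h2.2]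

theorem isCompact_baryCell (F : Finset V) (A : Set V) : IsCompact (baryCell F A) := by
  refine (isCompact_univ_pi fun _ => isCompact_Icc).of_isClosed_subset ?_ (baryCell_subset F A)
  have : baryCell F A = (⋂ v, {x | 0 ≤ x v}) ∩ (⋂ (v) (_ : v.1 ∉ A), {x | x v = 0}) ∩
      {x | ∑ v, x v = 1} := by
    ext x; simp [baryCell, and_assoc]
  rw [this]
  refine IsClosed.inter (IsClosed.inter ?_ ?_) ?_
  · exact isClosed_iInter fun v => isClosed_le continuous_const (continuous_apply v)
  · exact isClosed_iInter fun v => isClosed_iInter fun _ =>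
      isClosed_eq (continuous_apply v) continuous_const
  · exact isClosed_eq (by fun_prop) continuous_const

/-- The points supported in `F`, in barycentric coordinates. -/
def baryUnion (X : SComplex V) (F : Finset V) : Set (F → ℝ) :=
  ⋃ σ ∈ {σ | σ ∈ F.powerset ∧ σ ∈ X.faces}, baryCell F (σ : Set V)

theorem isCompact_baryUnion (X : SComplex V) (F : Finset V) : IsCompact (X.baryUnion F) :=
  (Set.Finite.subset (Finset.finite_toSet F.powerset) fun _ h => h.1).isCompact_biUnion
    fun _ _ => isCompact_baryCell _ _

variable [DecidableEq V]

/-- The lists of vertices spanning a (possibly empty) simplex. -/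
def faceLists (X : SComplex V) : Set (List V) := {l | l = [] ∨ l.toFinset ∈ X.faces}

theorem mem_faceLists_of_subset {X : SComplex V} {σ : Finset V} (hσ : σ ∈ X.faces) {l : List V}
    (hl : ∀ v ∈ l, v ∈ σ) : l ∈ X.faceLists := by
  rcases l.eq_nil_or_concat with rfl | ⟨l', v, rfl⟩
  · exact Or.inl rfl
  · refine Or.inr (X.down_closed σ hσ _ ?_ ?_)
    · intro x hx
      exact hl x (List.mem_toFinset.1 hx)
    · exact ⟨v, by simp⟩

theorem faceLists_subset_closed {X : SComplex V} {l : List V} (hl : l ∈ X.faceLists)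
    {l' : List V} (h : l' ⊆ l) : l' ∈ X.faceLists := by
  rcases hl with rfl | hl
  · exact Or.inl (List.subset_nil.1 h)
  · exact mem_faceLists_of_subset hl fun v hv => List.mem_toFinset.2 (h hv)

theorem sum_le_one_of_mem_realization {X : SComplex V} {f : V → ℝ} (hf : f ∈ X.realization)
    (s : Finset V) : ∑ v ∈ s, f v ≤ 1 := by
  obtain ⟨h0, σ, -, hσ, hsum⟩ := hf
  rw [← hsum]
  refine (Finset.sum_le_sum_of_subset_of_nonneg (Finset.subset_union_left (s₂ := σ))
    fun v _ _ => h0 v).trans (le_of_eq ?_)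
  exact (Finset.sum_subset Finset.subset_union_right fun v _ hv => hσ v hv).symm

/-- On a finite-dimensional complex, picking a vertex with a large barycentric coordinate is
locally a map into a single simplex. -/
theorem exists_vertex_selection (X : SComplex V) (hfd : X.IsFiniteDimensional) :
    ∃ w : X.realization → V, (∀ y : X.realization, y.1 (w y) ≠ 0) ∧
      ∃ U : X.realization → Set X.realization, (∀ y, IsOpen (U y) ∧ y ∈ U y) ∧
        ∀ y, ∃ σ ∈ X.faces, ∀ z ∈ U y, w z ∈ σ := by
  obtain ⟨N, hN⟩ := hfd
  have hNpos : (0 : ℝ) < N + 1 := by positivity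
  have hex : ∀ y : X.realization, ∃ v, 1 / ((N : ℝ) + 1) ≤ y.1 v := by
    rintro ⟨f, h0, σ, hσ, hz, hsum⟩
    by_contra! hcon
    have hlt : ∑ v ∈ σ, f v < ∑ v ∈ σ, 1 / ((N : ℝ) + 1) :=
      Finset.sum_lt_sum_of_nonempty (X.nonempty_of_mem σ hσ) fun v _ => hcon v
    rw [hsum, Finset.sum_const, nsmul_eq_mul, mul_one_div, lt_div_iff₀ hNpos, one_mul] at hlt
    have : (σ.card : ℝ) ≤ N + 1 := by exact_mod_cast hN σ hσ
    linarith
  choose w hw using hex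
  have hwpos : ∀ y : X.realization, 0 < y.1 (w y) := fun y => lt_of_lt_of_le (by positivity) (hw y)
  choose h0 σ hσ hz hsum using fun y : X.realization => y.2
  let η : ℝ := 1 / ((N : ℝ) + 1) / (N + 1)
  have hη : 0 < η := by positivity
  refine ⟨w, fun y => (hwpos y).ne', fun y : X.realization => {z | ∀ v ∈ σ y, y.1 v - z.1 v < η},
    fun y => ⟨?_, ?_⟩, fun y => ⟨σ y, hσ y, fun z hzU => ?_⟩⟩
  · have : {z : X.realization | ∀ v ∈ σ y, y.1 v - z.1 v < η} =
        ⋂ v ∈ σ y, {z : X.realization | y.1 v - z.1 v < η} := by ext; simp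
    beta_reduce
    rw [this]
    refine isOpen_biInter_finset fun v _ => isOpen_lt ?_ continuous_const
    exact continuous_const.sub ((continuous_apply v).comp continuous_subtype_val)
  · simp [hη]
  · by_contra hcon
    have h1 := sum_le_one_of_mem_realization z.2 (insert (w z) (σ y))
    rw [Finset.sum_insert hcon] at h1
    have h2 : ∑ v ∈ σ y, (y.1 v - z.1 v) < ∑ v ∈ σ y, η :=
      Finset.sum_lt_sum_of_nonempty (X.nonempty_of_mem _ (hσ y)) fun v hv => hzU v hv
    rw [Finset.sum_sub_distrib, hsum, Finset.sum_const, nsmul_eq_mul] at h2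
    have h3 : ((σ y).card : ℝ) ≤ N + 1 := by exact_mod_cast hN _ (hσ y)
    have h4 : ((N : ℝ) + 1) * η = 1 / (N + 1) := by
      simp only [η]; field_simp
    have h5 := hw z
    nlinarith

theorem baryCell_nonempty {F : Finset V} {A : Set V} {v : V} (hv : v ∈ F) (hvA : v ∈ A) :
    (baryCell F A).Nonempty := by
  refine ⟨Pi.single ⟨v, hv⟩ 1, fun u => ?_, fun u hu => ?_, by simp⟩
  · by_cases h : u = ⟨v, hv⟩
    · subst h; simp
    · simp [h]
  · have : u ≠ ⟨v, hv⟩ := by rintro rfl; exact hu hvA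
    simp [this]

/-- Extension by zero of barycentric coordinates. -/
noncomputable def extendZero (F : Finset V) (x : F → ℝ) : V → ℝ :=
  fun v => if h : v ∈ F then x ⟨v, h⟩ else 0

theorem continuous_extendZero (F : Finset V) : Continuous (extendZero F) := by
  refine continuous_pi fun v => ?_
  by_cases h : v ∈ F
  · simpa [extendZero, h] using continuous_apply _
  · simpa [extendZero, h] using continuous_const

theorem extendZero_eq_zero {F : Finset V} {A : Set V} {x : F → ℝ} (hx : x ∈ baryCell F A)
    {v : V} (hv : v ∉ A) : extendZero F x v = 0 := by
  by_cases h : v ∈ F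
  · simpa [extendZero, h] using hx.2.1 ⟨v, h⟩ hv
  · simp [extendZero, h]

theorem extendZero_mem_realization {X : SComplex V} {F : Finset V} {σ : Finset V}
    (hσ : σ ∈ X.faces) {x : F → ℝ} (hx : x ∈ baryCell F σ) :
    extendZero F x ∈ X.realization := by
  refine ⟨fun v => ?_, σ, hσ, fun v hv => extendZero_eq_zero hx hv, ?_⟩
  · by_cases h : v ∈ F
    · simpa [extendZero, h] using hx.1 _
    · simp [extendZero, h]
  · have h1 : ∑ v ∈ σ, extendZero F x v = ∑ v ∈ F ∪ σ, extendZero F x v :=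
      Finset.sum_subset Finset.subset_union_right fun v _ hv => extendZero_eq_zero hx hv
    have h2 : ∑ v ∈ F, extendZero F x v = ∑ v ∈ F ∪ σ, extendZero F x v :=
      Finset.sum_subset Finset.subset_union_left fun v _ hv => by simp [extendZero, hv]
    rw [h1, ← h2, ← Finset.sum_coe_sort]
    simpa [extendZero] using hx.2.2

theorem extendZero_mem_realization_of_mem_baryUnion {X : SComplex V} {F : Finset V}
    {x : F → ℝ} (hx : x ∈ X.baryUnion F) : extendZero F x ∈ X.realization := by
  simp only [baryUnion, Set.mem_iUnion] at hx
  obtain ⟨σ, hσ, hx⟩ := hx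
  exact extendZero_mem_realization hσ.2 hx

/-- The augmented ordered chain complex of a contractible finite-dimensional complex is
acyclic. -/
theorem exists_bdry_eq_of_contractible {R : Type*} [CommRing R] {V : Type*} [DecidableEq V]
    (X : SComplex V) (hfd : X.IsFiniteDimensional) (hcontr : ContractibleSpace X.realization)
    {c : List V →₀ R} (hc : c ∈ Finsupp.supported R R X.faceLists) (hd : bdry c = 0) :
    ∃ b ∈ Finsupp.supported R R X.faceLists, bdry b = c := by
  classical
  obtain ⟨w, hw, U, hU, hUσ⟩ := exists_vertex_selection X hfd
  obtain ⟨y₁, ⟨H⟩⟩ := id_nullhomotopic X.realization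
  let F : Finset V := c.support.biUnion List.toFinset
  let K := X.baryUnion F
  have : CompactSpace K := isCompact_iff_compactSpace.1 (isCompact_baryUnion X F)
  let e : K → X.realization := fun x =>
    ⟨extendZero F x.1, extendZero_mem_realization_of_mem_baryUnion x.2⟩
  have he : Continuous e :=
    ((continuous_extendZero F).comp continuous_subtype_val).subtype_mk _
  let H' : ℝ × K → X.realization := fun p => H (Set.projIcc 0 1 zero_le_one p.1, e p.2)
  have hH' : Continuous H' := H.continuous.comp
    ((continuous_projIcc.comp continuous_fst).prodMk (he.comp continuous_snd))
  obtain ⟨δ, hδ, hleb⟩ := lebesgue_number_lemma_of_metric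
    (s := Set.Icc (0 : ℝ) 1 ×ˢ (Set.univ : Set K)) (isCompact_Icc.prod isCompact_univ)
    (fun y : X.realization => (hU y).1.preimage hH')
    (fun p _ => Set.mem_iUnion.2 ⟨H' p, (hU (H' p)).2⟩)
  obtain ⟨N, hN⟩ := exists_nat_gt (1 / δ)
  have hN0 : (0 : ℝ) < N := lt_trans (by positivity) hN
  have hN1 : 1 / (N : ℝ) < δ := by
    rw [div_lt_iff₀ hδ] at hN
    rw [div_lt_iff₀ hN0]
    linarith
  let φ : ℕ → (F → ℝ) → V := fun i x =>
    if h : x ∈ K then w (H' ((i : ℝ) / N, ⟨x, h⟩)) else w y₁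
  let T : Set (List V) := {l | l ∈ X.faceLists ∧ ∀ v ∈ l, v ∈ F}
  have hT : ∀ l ∈ T, ∀ l' : List V, l' ⊆ l → l' ∈ T := fun l hl l' h =>
    ⟨faceLists_subset_closed hl.1 h, fun v hv => hl.2 v (h hv)⟩
  let C : List V → Set (List (F → ℝ)) := fun l =>
    {m | ∀ x ∈ m, x ∈ baryCell F {v | v ∈ l} ∧ ∀ y ∈ m, dist x y < δ}
  have hcell : ∀ l ∈ T, ∀ x ∈ baryCell F {v | v ∈ l}, x ∈ K := by
    intro l hl x hx
    rcases hl.1 with rfl | hσ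
    · have h0 : ∀ v, x v = 0 := fun v => hx.2.1 v (by simp)
      have h1 := hx.2.2
      simp [h0] at h1
    · refine Set.mem_biUnion (x := l.toFinset) ⟨?_, hσ⟩ (by simpa using hx)
      rw [Finset.mem_powerset]
      intro v hv
      exact hl.2 v (List.mem_toFinset.1 hv)
  obtain ⟨s, hs0, hs⟩ := exists_chainMap_of_acyclic (R := R) hT C
    (fun l l' h m hm x hx => ⟨⟨(hm x hx).1.1, fun v hv => (hm x hx).1.2.1 v fun h' => hv (h h'),
      (hm x hx).1.2.2⟩, (hm x hx).2⟩) (by simp [C])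
    (fun l hl hne c hc hd => by
      obtain ⟨v, hv⟩ := List.exists_mem_of_ne_nil l hne
      exact exists_bdry_eq_of_convex (convex_baryCell F _)
        (baryCell_nonempty (hl.2 v hv) hv)
        (fun x hx y hy => dist_le_one_of_mem_baryCell hx hy) hδ hc hd)
  have hcT : c ∈ Finsupp.supported R R T := by
    rw [Finsupp.mem_supported] at hc ⊢
    intro l hl
    exact ⟨hc hl, fun v hv => Finset.mem_biUnion.2 ⟨l, hl, List.mem_toFinset.2 hv⟩⟩
  have hsd : bdry (s c) = 0 := by
    have := map_eq_of_mem_supported (bdry ∘ₗ s) (s ∘ₗ bdry) (fun l hl => (hs l hl).2) hcT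
    simpa [hd] using this
  have hsc : s c ∈ Finsupp.supported R R
      {m : List (F → ℝ) | ∀ x ∈ m, x ∈ K ∧ ∀ y ∈ m, dist x y < δ} := by
    refine map_mem_of_mem_supported s (fun l hl => ?_) hcT
    refine Finsupp.supported_mono ?_ (hs l hl).1
    exact fun m hm x hx => ⟨hcell l hl x (hm x hx).1, (hm x hx).2⟩
  obtain ⟨b, hb, hbd⟩ := exists_bdry_eq_push_of_contiguous (T := X.faceLists) N φ (w y₁)
    (by
      intro m hm i hi l' hl'
      rcases m with _ | ⟨x₀, m⟩
      · have : l' = [] := by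
          rw [List.eq_nil_iff_forall_not_mem]
          intro x hx
          simpa using hl' x hx
        exact Or.inl this
      have hi1 : ((i : ℝ) + 1) / N ≤ 1 := by
        rw [div_le_one hN0]; exact_mod_cast hi
      have hi0 : (0 : ℝ) ≤ (i : ℝ) / N := by positivity
      have hi2 : ((i : ℝ) + 1) / N = (i : ℝ) / N + 1 / N := by ring
      have hi3 : (0 : ℝ) < 1 / N := by positivity
      have hx₀ := (hm x₀ (by simp)).1
      obtain ⟨y, hy⟩ := hleb ((i : ℝ) / N, ⟨x₀, hx₀⟩) ⟨⟨hi0, by linarith⟩, trivial⟩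
      obtain ⟨σ, hσ, hyσ⟩ := hUσ y
      refine mem_faceLists_of_subset hσ fun v hv => ?_
      have key : ∀ x ∈ x₀ :: m, ∀ j : ℕ, (j = i ∨ j = i + 1) → φ j x ∈ σ := by
        intro x hx j hj
        have hxK := (hm x hx).1
        simp only [φ, dif_pos hxK]
        refine hyσ _ (hy ?_)
        rw [Metric.mem_ball, Prod.dist_eq]
        refine max_lt ?_ ((hm x hx).2 x₀ (by simp))
        rcases hj with rfl | rfl
        · simpa using hδ
        · rw [Real.dist_eq]
          push_cast
          rw [hi2, add_sub_cancel_left, abs_of_pos hi3]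
          exact hN1
      rcases hl' v hv with h | h
      · obtain ⟨x, hx, rfl⟩ := List.mem_map.1 h
        exact key x hx _ (Or.inl rfl)
      · obtain ⟨x, hx, rfl⟩ := List.mem_map.1 h
        exact key x hx _ (Or.inr rfl))
    (by
      intro m hm x hx
      have hxK := (hm x hx).1
      have h1 : Set.projIcc (0 : ℝ) 1 zero_le_one 1 = 1 := Set.projIcc_right _
      simp only [φ, dif_pos hxK, H', div_self hN0.ne', h1]
      rw [H.apply_one]
      rfl)
    (by
      intro l' hl'
      obtain ⟨σ, hσ, hyσ⟩ := hUσ y₁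
      exact mem_faceLists_of_subset hσ fun v hv => by
        rw [hl' v hv]; exact hyσ _ (hU y₁).2)
    hsc hsd
  obtain ⟨b', hb', hbd'⟩ := exists_bdry_eq_of_carried hT (push (φ 0) ∘ₗ s - LinearMap.id)
    (by
      intro l hl
      simp only [LinearMap.sub_apply, LinearMap.comp_apply, map_sub, bdry_push, (hs l hl).2,
        LinearMap.id_apply])
    (by simp [hs0])
    (by
      intro l hl
      refine Submodule.sub_mem _ ?_ (Finsupp.single_mem_supported _ _ (by simp))
      refine map_mem_of_mem_supported (push (φ 0)) (fun m hm => ?_) (hs l hl).1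
      rw [push_single]
      refine Finsupp.single_mem_supported _ _ ?_
      intro v hv
      obtain ⟨x, hx, rfl⟩ := List.mem_map.1 hv
      have hxc := (hm x hx).1
      have hxK := hcell l hl x hxc
      by_contra hcon
      have h0 := extendZero_eq_zero hxc hcon
      have h1 : Set.projIcc (0 : ℝ) 1 zero_le_one 0 = 0 := Set.projIcc_left _
      refine hw (e ⟨x, hxK⟩) ?_
      have h2 : φ 0 x = w (e ⟨x, hxK⟩) := by
        simp only [φ, dif_pos hxK, H', Nat.cast_zero, zero_div, h1]
        rw [H.apply_zero]
        rfl
      rw [h2] at h0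
      exact h0)
    hcT hd
  refine ⟨b - b', Submodule.sub_mem _ hb (Finsupp.supported_mono (fun l hl => hl.1) hb'), ?_⟩
  rw [map_sub, hbd, hbd']
  simp

end SComplex

namespace ListChain

section Shuffle

variable {R : Type*} [CommRing R] {P Q : Type*}

/-- The signed sum of all insertions of a point into a list. -/
noncomputable def insList (v : P) : List P → (List P →₀ R)
  | [] => Finsupp.single [v] 1
  | a :: l => Finsupp.single (v :: a :: l) 1 - cone a (insList v l)

/-- The signed shuffle product with a point. -/
noncomputable def ins (v : P) : (List P →₀ R) →ₗ[R] (List P →₀ R) :=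
  Finsupp.linearCombination R (insList v)

@[simp] theorem ins_nil (v : P) :
    ins v (Finsupp.single ([] : List P) (1 : R)) = Finsupp.single [v] 1 := by
  simp [ins, insList]

@[simp] theorem ins_cons (v a : P) (l : List P) :
    ins v (Finsupp.single (a :: l) (1 : R)) =
      Finsupp.single (v :: a :: l) 1 - cone a (ins v (Finsupp.single l 1)) := by
  simp [ins, insList]

theorem ins_cone (v a : P) (c : List P →₀ R) :
    ins v (cone a c) = cone v (cone a c) - cone a (ins v c) := by
  have : ins v ∘ₗ cone a = (cone v ∘ₗ cone a - cone a ∘ₗ ins v : (List P →₀ R) →ₗ[R] _) := by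
    ext l : 2
    simp
  exact LinearMap.congr_fun this c

/-- The sum of all substitutions of a point for one entry of a list. -/
noncomputable def substList (v : P) : List P → (List P →₀ R)
  | [] => 0
  | a :: l => Finsupp.single (v :: l) 1 + cone a (substList v l)

/-- The derivation substituting a point for the entries of a list. -/
noncomputable def subst (v : P) : (List P →₀ R) →ₗ[R] (List P →₀ R) :=
  Finsupp.linearCombination R (substList v)

@[simp] theorem subst_nil (v : P) : subst v (Finsupp.single ([] : List P) (1 : R)) = 0 := by
  simp [subst, substList]

@[simp] theorem subst_cons (v a : P) (l : List P) :
    subst v (Finsupp.single (a :: l) (1 : R)) =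
      Finsupp.single (v :: l) 1 + cone a (subst v (Finsupp.single l 1)) := by
  simp [subst, substList]

theorem subst_cone (v a : P) (c : List P →₀ R) :
    subst v (cone a c) = cone v c + cone a (subst v c) := by
  have : subst v ∘ₗ cone a = (cone v + cone a ∘ₗ subst v : (List P →₀ R) →ₗ[R] _) := by
    ext l : 2
    simp
  exact LinearMap.congr_fun this c

theorem ins_ins (u v : P) (c : List P →₀ R) : ins v (ins u c) = - ins u (ins v c) := by
  have : (ins v ∘ₗ ins u : (List P →₀ R) →ₗ[R] _) = (-1 : R) • (ins u ∘ₗ ins v) := by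
    ext l : 2
    induction l with
    | nil => simp
    | cons a l ih =>
      simp only [LinearMap.comp_apply, Finsupp.lsingle_apply, LinearMap.smul_apply, neg_smul,
        one_smul] at ih ⊢
      have ih' := congrArg (cone a) ih
      simp only [map_neg] at ih'
      simp only [ins_cons, map_sub, ins_cone, ih', cone_single]
      abel
  simpa using LinearMap.congr_fun this c

theorem subst_ins (v a : P) (c : List P →₀ R) :
    subst v (ins a c) = ins a (subst v c) + ins v c := by
  have : subst v ∘ₗ ins a = (ins a ∘ₗ subst v + ins v : (List P →₀ R) →ₗ[R] _) := by
    ext l : 2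
    induction l with
    | nil => simp
    | cons b l ih =>
      simp only [LinearMap.comp_apply, Finsupp.lsingle_apply, LinearMap.add_apply] at ih ⊢
      simp only [ins_cons, subst_cons, map_sub, map_add, ins_cone, subst_cone, ih, cone_single]
      abel
  exact LinearMap.congr_fun this c

theorem bdry_ins (v : P) (l : List P) :
    bdry (ins v (Finsupp.single l (1 : R))) =
      ((l.length : R) + 1) • Finsupp.single l 1 - ins v (bdry (Finsupp.single l 1)) -
        subst v (Finsupp.single l 1) := by
  induction l with
  | nil => simp
  | cons b l ih =>
    simp only [ins_cons, subst_cons, bdry_cons, map_sub, bdry_cone, ih, ins_cone, map_smul,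
      cone_single, List.length_cons, Nat.cast_succ]
    module

/-- The signed sum of all permutations of a list. -/
noncomputable def altList : List P → (List P →₀ R)
  | [] => Finsupp.single [] 1
  | a :: l => ins a (altList l)

/-- The antisymmetrization of a chain. -/
noncomputable def alt : (List P →₀ R) →ₗ[R] (List P →₀ R) :=
  Finsupp.linearCombination R altList

@[simp] theorem alt_nil :
    alt (Finsupp.single ([] : List P) (1 : R)) = Finsupp.single [] 1 := by
  simp [alt, altList]

@[simp] theorem alt_cons (a : P) (l : List P) :
    alt (Finsupp.single (a :: l) (1 : R)) = ins a (alt (Finsupp.single l 1)) := by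
  simp [alt, altList]

theorem alt_cone (a : P) (c : List P →₀ R) : alt (cone a c) = ins a (alt c) := by
  have : alt ∘ₗ cone a = (ins a ∘ₗ alt : (List P →₀ R) →ₗ[R] _) := by
    ext l : 2
    simp
  exact LinearMap.congr_fun this c

theorem subst_alt (v : P) (c : List P →₀ R) : subst v (alt c) = ins v (alt (bdry c)) := by
  have : subst v ∘ₗ alt = (ins v ∘ₗ alt ∘ₗ bdry : (List P →₀ R) →ₗ[R] _) := by
    ext l : 2
    induction l with
    | nil => simp
    | cons b l ih =>
      simp only [LinearMap.comp_apply, Finsupp.lsingle_apply] at ih ⊢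
      rw [alt_cons, subst_ins, ih, bdry_cons, map_sub, map_sub, alt_cone, ins_ins v b]
      abel
  exact LinearMap.congr_fun this c

theorem ins_mem (v : P) (l : List P) : ins v (Finsupp.single l (1 : R)) ∈
    Finsupp.supported R R {l' | l'.Perm (v :: l)} := by
  induction l with
  | nil => simpa using Finsupp.single_mem_supported _ _ (by simp)
  | cons a l ih =>
    rw [ins_cons]
    refine Submodule.sub_mem _ (Finsupp.single_mem_supported _ _ (by simp)) ?_
    refine map_mem_of_mem_supported (cone a) (fun l' hl' => ?_) ih
    rw [cone_single]
    exact Finsupp.single_mem_supported _ _ ((List.Perm.cons a hl').trans (List.Perm.swap _ _ _))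

theorem alt_mem (l : List P) : alt (Finsupp.single l (1 : R)) ∈
    Finsupp.supported R R {l' | l'.Perm l} := by
  induction l with
  | nil => simpa using Finsupp.single_mem_supported _ _ (by simp)
  | cons a l ih =>
    rw [alt_cons]
    refine map_mem_of_mem_supported (ins a) (fun l' hl' => ?_) ih
    exact Finsupp.supported_mono (fun l'' h => h.trans (List.Perm.cons a hl')) (ins_mem a l')

theorem bdry_alt (l : List P) : bdry (alt (Finsupp.single l (1 : R))) =
    (l.length : R) • alt (bdry (Finsupp.single l 1)) := by
  induction l with
  | nil => simp
  | cons a l ih =>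
    have key : bdry (ins a (alt (Finsupp.single l (1 : R)))) =
        ((l.length : R) + 1) • alt (Finsupp.single l 1) -
          ins a (bdry (alt (Finsupp.single l 1))) - subst a (alt (Finsupp.single l 1)) := by
      refine map_eq_of_mem_supported (R := R) (M := List P →₀ R) (bdry ∘ₗ ins a)
        (((l.length : R) + 1) • LinearMap.id - ins a ∘ₗ bdry - subst a) (fun l' hl' => ?_)
        (alt_mem l)
      have := bdry_ins (R := R) a l'
      rw [hl'.length_eq] at this
      simpa using this
    rw [alt_cons, key, ih, subst_alt, bdry_cons, map_sub, alt_cone, List.length_cons,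
      Nat.cast_succ, map_smul]
    module

theorem push_ins (f : P → Q) (v : P) (c : List P →₀ R) :
    push f (ins v c) = ins (f v) (push f c) := by
  have : push f ∘ₗ ins v = (ins (f v) ∘ₗ push f : (List P →₀ R) →ₗ[R] _) := by
    ext l : 2
    induction l with
    | nil => simp
    | cons a l ih =>
      simp only [LinearMap.comp_apply, Finsupp.lsingle_apply, push_single] at ih ⊢
      simp [ih, push_cone]
  exact LinearMap.congr_fun this c

theorem push_alt (f : P → Q) (c : List P →₀ R) : push f (alt c) = alt (push f c) := by
  have : push f ∘ₗ alt = (alt ∘ₗ push f : (List P →₀ R) →ₗ[R] _) := by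
    ext l : 2
    induction l with
    | nil => simp
    | cons a l ih =>
      simp only [LinearMap.comp_apply, Finsupp.lsingle_apply, push_single] at ih ⊢
      simp [ih, push_ins]
  exact LinearMap.congr_fun this c

end Shuffle

section Field

variable {R : Type*} [Field R] {P Q : Type*}

/-- The normalized antisymmetrization, a chain map. -/
noncomputable def antisymm : (List P →₀ R) →ₗ[R] (List P →₀ R) :=
  Finsupp.linearCombination R fun l => (l.length.factorial : R)⁻¹ • alt (Finsupp.single l 1)

theorem antisymm_single (l : List P) : antisymm (Finsupp.single l (1 : R)) =
    (l.length.factorial : R)⁻¹ • alt (Finsupp.single l 1) := by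
  simp [antisymm]

theorem antisymm_nil :
    antisymm (Finsupp.single ([] : List P) (1 : R)) = Finsupp.single [] 1 := by
  simp [antisymm_single]

theorem antisymm_mem (l : List P) : antisymm (Finsupp.single l (1 : R)) ∈
    Finsupp.supported R R {l' | l'.Perm l} := by
  rw [antisymm_single]
  exact Submodule.smul_mem _ _ (alt_mem l)

theorem push_antisymm (f : P → Q) (c : List P →₀ R) :
    push f (antisymm c) = antisymm (push f c) := by
  have : push f ∘ₗ antisymm = (antisymm ∘ₗ push f : (List P →₀ R) →ₗ[R] _) := by
    ext l : 2
    simp [antisymm_single, push_alt]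
  exact LinearMap.congr_fun this c

variable [CharZero R]

theorem ins_ins_self (v : P) (c : List P →₀ R) : ins v (ins v c) = 0 := by
  have h := ins_ins v v c
  have h2 : (2 : R) • ins v (ins v c) = 0 := by
    rw [two_smul]
    nth_rewrite 1 [h]
    simp
  exact (smul_eq_zero.1 h2).resolve_left two_ne_zero

theorem alt_eq_zero_of_not_nodup {l : List P} (hl : ¬ l.Nodup) :
    alt (Finsupp.single l (1 : R)) = 0 := by
  have key : ∀ (v : P) (l : List P), v ∈ l → ins v (alt (Finsupp.single l (1 : R))) = 0 := by
    intro v l hv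
    induction l with
    | nil => simp at hv
    | cons a l ih =>
      rw [alt_cons]
      rcases List.mem_cons.1 hv with rfl | h
      · exact ins_ins_self _ _
      · rw [ins_ins, ih h]; simp
  induction l with
  | nil => simp at hl
  | cons a l ih =>
    rw [alt_cons]
    by_cases h : a ∈ l
    · exact key a l h
    · rw [ih (fun h' => hl (List.nodup_cons.2 ⟨h, h'⟩)), map_zero]

theorem antisymm_eq_zero_of_not_nodup {l : List P} (hl : ¬ l.Nodup) :
    antisymm (Finsupp.single l (1 : R)) = 0 := by
  rw [antisymm_single, alt_eq_zero_of_not_nodup hl, smul_zero]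

theorem bdry_antisymm (c : List P →₀ R) : bdry (antisymm c) = antisymm (bdry c) := by
  have : bdry ∘ₗ antisymm = (antisymm ∘ₗ bdry : (List P →₀ R) →ₗ[R] _) := by
    ext l : 2
    simp only [LinearMap.comp_apply, Finsupp.lsingle_apply]
    rw [antisymm_single, map_smul, bdry_alt]
    rcases l with _ | ⟨a, l⟩
    · simp
    have h : antisymm (bdry (Finsupp.single (a :: l) (1 : R))) =
        (l.length.factorial : R)⁻¹ • alt (bdry (Finsupp.single (a :: l) (1 : R))) := by
      refine map_eq_of_mem_supported (R := R) (M := List P →₀ R) antisymm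
        ((l.length.factorial : R)⁻¹ • alt) (fun l' hl' => ?_) (bdry_mem (a :: l))
      have hlen : l'.length = l.length := by simpa using hl'.2
      rw [antisymm_single, hlen, LinearMap.smul_apply]
    rw [h, smul_smul, List.length_cons, Nat.factorial_succ]
    congr 1
    have h1 : ((l.length + 1 : ℕ) : R) ≠ 0 := Nat.cast_ne_zero.2 (Nat.succ_ne_zero _)
    have h2 : (l.length.factorial : R) ≠ 0 := Nat.cast_ne_zero.2 (Nat.factorial_ne_zero _)
    push_cast at h1 ⊢
    field_simp
  exact LinearMap.congr_fun this c

end Field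

end ListChain

namespace Rep

open CategoryTheory

variable {k G : Type} [CommRing k] [Group G]

/-- An elementwise criterion for exactness of a short complex of representations. -/
theorem exact_of_forall_exists (S : ShortComplex (Rep.{0} k G))
    (h : ∀ x : S.X₂, S.g.hom x = 0 → ∃ y : S.X₁, S.f.hom y = x) : S.Exact := by
  apply (forget₂ (Rep.{0} k G) (ModuleCat k)).reflects_exact_of_faithful
  rw [ShortComplex.moduleCat_exact_iff]
  exact h

/-- A complex of representations is a resolution if it is exact elementwise. -/
theorem quasiIso_toSingle₀ (C : ChainComplex (Rep.{0} k G) ℕ)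
    (ε : C.X 0 ⟶ Rep.trivial k G k) (hε : C.d 1 0 ≫ ε = 0)
    (hsurj : Function.Surjective ε.hom)
    (h0 : ∀ x : C.X 0, ε.hom x = 0 → ∃ y : C.X 1, (C.d 1 0).hom y = x)
    (hex : ∀ n, ∀ x : C.X (n + 1), (C.d (n + 1) n).hom x = 0 →
      ∃ y : C.X (n + 2), (C.d (n + 2) (n + 1)).hom y = x) :
    QuasiIso ((C.toSingle₀Equiv (Rep.trivial k G k)).symm ⟨ε, hε⟩) := by
  refine ⟨fun n => ?_⟩
  cases n with
  | zero =>
    rw [ChainComplex.quasiIsoAt₀_iff, ShortComplex.quasiIso_iff_of_zeros' _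
      (C.shape 0 0 (by simp)) rfl rfl]
    refine ⟨exact_of_forall_exists _ fun x hx => ?_, ?_⟩
    · have : ((C.toSingle₀Equiv (Rep.trivial k G k)).symm ⟨ε, hε⟩).f 0 = ε :=
        ChainComplex.toSingle₀Equiv_symm_apply_f_zero ..
      exact h0 x ((congrArg (fun f : C.X 0 ⟶ Rep.trivial k G k => f.hom x) this).symm.trans hx)
    · rw [Rep.epi_iff_surjective]
      intro x
      obtain ⟨y, hy⟩ := hsurj x
      have : ((C.toSingle₀Equiv (Rep.trivial k G k)).symm ⟨ε, hε⟩).f 0 = ε :=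
        ChainComplex.toSingle₀Equiv_symm_apply_f_zero ..
      exact ⟨y, (congrArg (fun f : C.X 0 ⟶ Rep.trivial k G k => f.hom y) this).trans hy⟩
  | succ n =>
    rw [quasiIsoAt_iff_exactAt' (hL := ChainComplex.exactAt_succ_single_obj ..),
      HomologicalComplex.exactAt_iff' _ (n + 2) (n + 1) n (by simp) (by simp)]
    exact exact_of_forall_exists _ (hex n)

/-- If the trivial representation has a projective resolution with an augmented endomorphism
vanishing in a positive degree, then cohomology vanishes in that degree. -/
theorem subsingleton_groupCohomology_of_endomorphism
    (P : ProjectiveResolution (Rep.trivial k G k)) (e : P.complex ⟶ P.complex)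
    (he : e ≫ P.π = P.π) {m : ℕ} (hm : e.f (m + 1) = 0) (A : Rep.{0} k G) :
    Subsingleton (groupCohomology A (m + 1)) := by
  have H : Homotopy (𝟙 P.complex) e :=
    ProjectiveResolution.liftHomotopy (𝟙 _) _ _ (by simp) (by simp [he])
  have hcomm := H.comm (m + 1)
  rw [hm, add_zero, dNext_eq _ (show (ComplexShape.down ℕ).Rel (m + 1) m by simp),
    prevD_eq _ (show (ComplexShape.down ℕ).Rel (m + 2) (m + 1) by simp)] at hcomm
  have hz : Limits.IsZero ((P.complex.linearYonedaObj k A).homology (m + 1)) := by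
    rw [← HomologicalComplex.exactAt_iff_isZero_homology,
      HomologicalComplex.exactAt_iff' _ m (m + 1) (m + 2) (by simp) (by simp),
      ShortComplex.moduleCat_exact_iff]
    intro (f : P.complex.X (m + 1) ⟶ A) hf
    refine ⟨(H.hom m (m + 1) ≫ f : P.complex.X m ⟶ A), ?_⟩
    have hf' : P.complex.d (m + 2) (m + 1) ≫ f = 0 := hf
    show P.complex.d (m + 1) m ≫ H.hom m (m + 1) ≫ f = f
    have := congrArg (· ≫ f) hcomm
    simpa [hf'] using this.symm
  have := hz.of_iso (groupCohomologyIso A (m + 1) P)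
  exact ModuleCat.subsingleton_of_isZero this

/-- If an exact augmented complex of projective representations has an augmented endomorphism
vanishing in a positive degree, then group cohomology vanishes in that degree. -/
theorem subsingleton_groupCohomology_of_exact (C : ChainComplex (Rep.{0} k G) ℕ)
    (hproj : ∀ n, Projective (C.X n)) (ε : C.X 0 ⟶ Rep.trivial k G k) (hε : C.d 1 0 ≫ ε = 0)
    (hsurj : Function.Surjective ε.hom)
    (h0 : ∀ x : C.X 0, ε.hom x = 0 → ∃ y : C.X 1, (C.d 1 0).hom y = x)
    (hex : ∀ n, ∀ x : C.X (n + 1), (C.d (n + 1) n).hom x = 0 →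
      ∃ y : C.X (n + 2), (C.d (n + 2) (n + 1)).hom y = x)
    (e : C ⟶ C) (he : e.f 0 ≫ ε = ε) {m : ℕ} (hm : e.f (m + 1) = 0) (A : Rep.{0} k G) :
    Subsingleton (groupCohomology A (m + 1)) := by
  let P : ProjectiveResolution (Rep.trivial k G k) :=
    { complex := C
      projective := hproj
      π := (C.toSingle₀Equiv _).symm ⟨ε, hε⟩
      quasiIso := quasiIso_toSingle₀ C ε hε hsurj h0 hex }
  refine subsingleton_groupCohomology_of_endomorphism P e ?_ hm A
  apply (C.toSingle₀Equiv (Rep.trivial k G k)).injective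
  apply Subtype.ext
  have : ((C.toSingle₀Equiv (Rep.trivial k G k)).symm ⟨ε, hε⟩).f 0 = ε :=
    ChainComplex.toSingle₀Equiv_symm_apply_f_zero ..
  simpa [P, ChainComplex.toSingle₀Equiv] using he

/-- In characteristic zero, a permutation representation with finite stabilizers is projective. -/
theorem projective_of_basis {k G S : Type} [Field k] [CharZero k] [Group G] [MulAction G S]
    (hfin : ∀ s : S, {g : G | g • s = s}.Finite) (A : Rep.{0} k G) (b : Module.Basis S k A)
    (hb : ∀ (g : G) (s : S), A.ρ g (b s) = b (g • s)) : Projective A := by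
  classical
  let r : S → S := fun s => (Quotient.mk (MulAction.orbitRel G S) s).out
  have hr : ∀ (g : G) s, r (g • s) = r s := fun g s => congrArg Quotient.out
    (Quotient.sound (s := MulAction.orbitRel G S) ⟨g, rfl⟩)
  have hr' : ∀ s, ∃ t : G, t • r s = s := fun s =>
    (MulAction.orbitRel G S).symm (Quotient.mk_out (s := MulAction.orbitRel G S) s)
  have hT : ∀ s, {t : G | t • r s = s}.Finite := fun s => by
    obtain ⟨t₀, ht₀⟩ := hr' s
    refine ((hfin (r s)).image (t₀ * ·)).subset fun t ht => ⟨t₀⁻¹ * t, ?_, by simp⟩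
    simp only [Set.mem_ofPred_eq] at ht ⊢
    rw [mul_smul, ht, inv_smul_eq_iff, ht₀]
  refine ⟨fun {E X} f e he => ?_⟩
  obtain ⟨a, ha⟩ := ((Rep.epi_iff_surjective e).1 he).hasRightInverse
  let L : S → E := fun s =>
    ((hT s).toFinset.card : k)⁻¹ • ∑ t ∈ (hT s).toFinset, E.ρ t (a (f.hom (b (r s))))
  have hL : ∀ (g : G) s, E.ρ g (L s) = L (g • s) := by
    intro g s
    have himg : (hT (g • s)).toFinset = (hT s).toFinset.image (g * ·) := by
      ext t
      simp only [Set.Finite.mem_toFinset, Set.mem_ofPred_eq, Finset.mem_image, hr]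
      constructor
      · intro h
        exact ⟨g⁻¹ * t, by rw [mul_smul, h, inv_smul_smul], by simp⟩
      · rintro ⟨u, hu, rfl⟩
        rw [mul_smul, hu]
    simp only [L]
    rw [himg, Finset.card_image_of_injective _ (mul_right_injective g),
      Finset.sum_image fun _ _ _ _ h => mul_right_injective g h, map_smul, map_sum, hr]
    simp only [map_mul, Module.End.mul_apply]
  have heL : ∀ s, e.hom (L s) = f.hom (b s) := by
    intro s
    simp only [L, map_smul, map_sum]
    have : ∀ t ∈ (hT s).toFinset, e.hom (E.ρ t (a (f.hom (b (r s))))) = f.hom (b s) := by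
      intro t ht
      rw [hom_comm_apply, ha, ← hom_comm_apply, hb, (Set.Finite.mem_toFinset _).1 ht]
    rw [Finset.sum_congr rfl this, Finset.sum_const, ← Nat.cast_smul_eq_nsmul k, smul_smul,
      inv_mul_cancel₀, one_smul]
    obtain ⟨t, ht⟩ := hr' s
    exact Nat.cast_ne_zero.2 (Finset.card_ne_zero.2 ⟨t, (Set.Finite.mem_toFinset _).2 ht⟩)
  refine ⟨Rep.ofHom ⟨b.constr k L, fun g => b.ext fun s => ?_⟩, ?_⟩
  · simp [hb, hL]
  · ext x
    have : e.hom.toLinearMap ∘ₗ b.constr k L = f.hom.toLinearMap := b.ext fun s => by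
      simpa using heL s
    exact LinearMap.congr_fun this x

end Rep

namespace ListChain

variable {R : Type*} [CommRing R] {P Q : Type*}

/-- The part of a chain supported on lists of length `n`. -/
noncomputable def homog (n : ℕ) : (List P →₀ R) →ₗ[R] (List P →₀ R) :=
  Finsupp.linearCombination R fun l => if l.length = n then Finsupp.single l 1 else 0

theorem homog_single (n : ℕ) (l : List P) : homog n (Finsupp.single l (1 : R)) =
    if l.length = n then Finsupp.single l 1 else 0 := by
  simp [homog]

theorem homog_mem {S : Set (List P)} (n : ℕ) {c : List P →₀ R} (hc : c ∈ Finsupp.supported R R S) :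
    homog n c ∈ Finsupp.supported R R {l | l.length = n ∧ l ∈ S} := by
  refine map_mem_of_mem_supported _ (fun l hl => ?_) hc
  rw [homog_single]
  split_ifs with h
  · exact Finsupp.single_mem_supported _ _ ⟨h, hl⟩
  · exact zero_mem _

theorem homog_eq_self {n : ℕ} {c : List P →₀ R}
    (hc : c ∈ Finsupp.supported R R {l | l.length = n}) : homog n c = c := by
  refine map_eq_of_mem_supported (homog n) LinearMap.id (fun l hl => ?_) hc
  exact (homog_single n l).trans (if_pos hl)

theorem bdry_homog (n : ℕ) (c : List P →₀ R) : bdry (homog (n + 1) c) = homog n (bdry c) := by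
  have : bdry ∘ₗ homog (n + 1) = (homog n ∘ₗ bdry : (List P →₀ R) →ₗ[R] _) := by
    ext l : 2
    simp only [LinearMap.comp_apply, Finsupp.lsingle_apply]
    rw [homog_single]
    split_ifs with h
    · rw [homog_eq_self]
      refine Finsupp.supported_mono (fun l' hl' => ?_) (bdry_mem l)
      exact Nat.succ_injective (hl'.2.trans h)
    · rw [map_zero]
      symm
      refine map_eq_of_mem_supported (R := R) (M := List P →₀ R) (homog n) 0 (fun l' hl' => ?_)
        (bdry_mem l)
      exact (homog_single n l').trans (if_neg fun h' => h (by rw [← hl'.2, h']))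
  exact LinearMap.congr_fun this c

end ListChain

namespace SComplex

open ListChain CategoryTheory

section

theorem card_le_dim_add_one {V : Type} {X : SComplex V} (hfd : X.IsFiniteDimensional)
    {σ : Finset V} (hσ : σ ∈ X.faces) : σ.card ≤ X.dim + 1 := by
  obtain ⟨N, hN⟩ := hfd
  obtain ⟨n, hn⟩ := Nat.exists_eq_succ_of_ne_zero (X.nonempty_of_mem σ hσ).card_pos.ne'
  rw [hn]
  refine Nat.succ_le_succ (le_csSup ⟨N, ?_⟩ ⟨σ, hσ, hn⟩)
  rintro m ⟨τ, hτ, hm⟩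
  have := hN τ hτ
  omega

variable {V : Type} [DecidableEq V] (X : SComplex V)

/-- The lists of `n + 1` vertices spanning a simplex. -/
def orderedSimplices (n : ℕ) : Set (List V) := {l | l.length = n + 1 ∧ l ∈ X.faceLists}

/-- The module of ordered simplicial chains. -/
abbrev chains (n : ℕ) : Submodule ℚ (List V →₀ ℚ) := Finsupp.supported ℚ ℚ (X.orderedSimplices n)

theorem bdry_mem_chains {n : ℕ} {c : List V →₀ ℚ} (hc : c ∈ X.chains (n + 1)) :
    bdry c ∈ X.chains n := by
  refine map_mem_of_mem_supported bdry (fun l hl => ?_) hc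
  refine Finsupp.supported_mono (fun l' hl' => ?_) (bdry_mem l)
  exact ⟨Nat.succ_injective (hl'.2.trans hl.1), faceLists_subset_closed hl.2 hl'.1.subset⟩

theorem antisymm_mem_chains {n : ℕ} {c : List V →₀ ℚ} (hc : c ∈ X.chains n) :
    ListChain.antisymm c ∈ X.chains n := by
  refine map_mem_of_mem_supported ListChain.antisymm (fun l hl => ?_) hc
  refine Finsupp.supported_mono (fun l' hl' => ?_) (antisymm_mem l)
  exact ⟨hl'.length_eq.trans hl.1, faceLists_subset_closed hl.2 hl'.subset⟩

variable {X} in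
theorem antisymm_eq_zero_of_dim_lt (hfd : X.IsFiniteDimensional) {n : ℕ} (hn : X.dim < n)
    {c : List V →₀ ℚ} (hc : c ∈ X.chains n) : ListChain.antisymm c = 0 := by
  refine map_eq_of_mem_supported ListChain.antisymm 0 (fun l hl => ?_) hc
  refine antisymm_eq_zero_of_not_nodup fun hnd => ?_
  rcases hl.2 with h | h
  · simpa [h] using hl.1
  · have := card_le_dim_add_one hfd h
    rw [List.toFinset_card_of_nodup hnd, hl.1] at this
    omega

variable {X} in
theorem exists_bdry_eq_of_mem_chains (hfd : X.IsFiniteDimensional)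
    (hcontr : ContractibleSpace X.realization) {n : ℕ} {c : List V →₀ ℚ} (hc : c ∈ X.chains n)
    (hd : bdry c = 0) : ∃ b ∈ X.chains (n + 1), bdry b = c := by
  obtain ⟨b, hb, rfl⟩ := exists_bdry_eq_of_contractible X hfd hcontr
    (Finsupp.supported_mono (fun _ h => h.2) hc) hd
  refine ⟨homog (n + 2) b, homog_mem _ hb, ?_⟩
  rw [bdry_homog, homog_eq_self (Finsupp.supported_mono (fun _ h => h.1) hc)]

variable {G : Type} [Group G] [MulAction G V]

/-- The permutation representation on all chains of lists of vertices. -/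
noncomputable def listRep (V G : Type) [Group G] [MulAction G V] :
    Representation ℚ G (List V →₀ ℚ) where
  toFun g := push (g • ·)
  map_one' := by
    ext l : 2
    simp
  map_mul' g h := by
    ext l : 2
    simp [mul_smul, Function.comp_def]

variable {X} in
theorem push_smul_mem_chains (hact : X.IsSimplicialAction G) (g : G) {n : ℕ} {c : List V →₀ ℚ}
    (hc : c ∈ X.chains n) : push (g • ·) c ∈ X.chains n := by
  refine map_mem_of_mem_supported (push (g • ·)) (fun l hl => ?_) hc
  rw [push_single]
  refine Finsupp.single_mem_supported _ _ ⟨by simpa using hl.1, ?_⟩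
  rcases hl.2 with h | h
  · simp [h, faceLists]
  · right
    have := hact g _ h
    convert this using 1
    ext; simp

end

end SComplex

namespace SComplex

open ListChain CategoryTheory

variable {V : Type} [DecidableEq V] {X : SComplex V} {G : Type} [Group G] [MulAction G V]

/-- The representation on ordered simplicial chains. -/
noncomputable abbrev chainRep (hact : X.IsSimplicialAction G) (n : ℕ) : Rep.{0} ℚ G :=
  Rep.of ((listRep V G).subrepresentation (X.chains n)
    fun g _ hc => push_smul_mem_chains hact g hc)

/-- The boundary of ordered simplicial chains. -/
noncomputable def chainBdry (hact : X.IsSimplicialAction G) (n : ℕ) :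
    chainRep hact (n + 1) ⟶ chainRep hact n :=
  Rep.ofHom ⟨bdry.restrict fun _ hc => X.bdry_mem_chains hc,
    fun g => LinearMap.ext fun c => Subtype.ext (bdry_push (g • ·) c.1)⟩

/-- The complex of ordered simplicial chains. -/
noncomputable def chainComplex (hact : X.IsSimplicialAction G) : ChainComplex (Rep.{0} ℚ G) ℕ :=
  ChainComplex.of (chainRep hact) (chainBdry hact) fun n => by
    refine Rep.hom_ext ?_
    ext c : 2
    exact Subtype.ext (bdry_bdry c.1)

theorem chainComplex_d (hact : X.IsSimplicialAction G) (n : ℕ) :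
    (chainComplex hact).d (n + 1) n = chainBdry hact n :=
  ChainComplex.of_d ..

/-- Antisymmetrization of ordered simplicial chains. -/
noncomputable def chainAntisymm (hact : X.IsSimplicialAction G) :
    chainComplex hact ⟶ chainComplex hact :=
  ChainComplex.ofHom
    (fun n => Rep.ofHom ⟨ListChain.antisymm.restrict fun _ hc => X.antisymm_mem_chains hc,
      fun g => LinearMap.ext fun c => Subtype.ext (push_antisymm (g • ·) c.1).symm⟩)
    fun n => by
      rw [chainComplex_d]
      refine Rep.hom_ext ?_
      ext c : 2
      exact Subtype.ext (bdry_antisymm c.1)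

/-- The augmentation of the complex of ordered simplicial chains. -/
noncomputable def chainAug (hact : X.IsSimplicialAction G) :
    chainRep hact 0 ⟶ Rep.trivial ℚ G ℚ :=
  Rep.ofHom ⟨Finsupp.lapply [] ∘ₗ bdry ∘ₗ (X.chains 0).subtype, fun g => by
    refine LinearMap.ext fun c => ?_
    show bdry (push (g • ·) c.1) [] = bdry c.1 []
    rw [bdry_push]
    generalize bdry c.1 = d
    have : Finsupp.lapply [] ∘ₗ push (g • ·) =
        (Finsupp.lapply [] : (List V →₀ ℚ) →ₗ[ℚ] ℚ) := by
      ext l : 2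
      cases l <;> simp
    exact LinearMap.congr_fun this d⟩

theorem bdry_eq_of_mem_chains_zero {c : List V →₀ ℚ} (hc : c ∈ X.chains 0) :
    bdry c = Finsupp.single [] (bdry c []) := by
  refine map_eq_of_mem_supported (R := ℚ) bdry
    (Finsupp.lsingle [] ∘ₗ Finsupp.lapply [] ∘ₗ bdry) (fun l hl => ?_) hc
  obtain ⟨v, rfl⟩ := List.length_eq_one_iff.1 hl.1
  simp

theorem projective_chainRep (hact : X.IsSimplicialAction G) (hstab : X.HasFiniteStabilizers G)
    (n : ℕ) : Projective (chainRep hact n) := by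
  let _ : MulAction G (X.orderedSimplices n) :=
    { smul := fun g l => ⟨l.1.map (g • ·), by simpa using l.2.1, by
        rcases l.2.2 with h | h
        · simp [h, faceLists]
        · right
          convert hact g _ h using 1
          ext; simp⟩
      one_smul := fun l => Subtype.ext (by show l.1.map ((1 : G) • ·) = l.1; simp)
      mul_smul := fun g h l => Subtype.ext (by
        show l.1.map ((g * h) • ·) = (l.1.map (h • ·)).map (g • ·)
        simp [mul_smul, Function.comp_def]) }
  refine Rep.projective_of_basis (S := X.orderedSimplices n) (fun s => ?_) (chainRep hact n)
    (Module.Basis.ofRepr (Finsupp.supportedEquivFinsupp (X.orderedSimplices n))) fun g s => ?_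
  · rcases s.2.2 with h | h
    · simpa [h] using s.2.1
    · refine (hstab _ h).subset fun g hg => ?_
      have hg' : s.1.map (g • ·) = s.1 := congrArg Subtype.val hg
      show Finset.image _ _ = _
      conv_rhs => rw [← hg']
      ext; simp
  · apply Subtype.ext
    have hb : ∀ t : X.orderedSimplices n, ((Finsupp.supportedEquivFinsupp (R := ℚ) (M := ℚ)
        (X.orderedSimplices n)).symm (Finsupp.single t 1) : List V →₀ ℚ) = Finsupp.single t.1 1 :=
      fun t => by classical exact Finsupp.supportedEquivFinsupp_symm_single _ t 1
    exact ((congrArg (push (g • ·)) (hb s)).trans (push_single _ _ _)).trans (hb (g • s)).symm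

/-- Rational group cohomology vanishes above the dimension of a contractible complex with an
action with finite stabilizers. -/
theorem subsingleton_groupCohomology (hact : X.IsSimplicialAction G)
    (hstab : X.HasFiniteStabilizers G) (hfd : X.IsFiniteDimensional)
    (hcontr : ContractibleSpace X.realization) (A : Rep.{0} ℚ G) {m : ℕ} (hm : X.dim < m) :
    Subsingleton (groupCohomology A m) := by
  obtain ⟨m, rfl⟩ := Nat.exists_eq_succ_of_ne_zero (Nat.ne_zero_of_lt hm)
  refine Rep.subsingleton_groupCohomology_of_exact (chainComplex hact)
    (projective_chainRep hact hstab) (chainAug hact) ?_ ?_ ?_ ?_ (chainAntisymm hact) ?_ ?_ A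
  · rw [chainComplex_d]
    ext c
    exact DFunLike.congr_fun (bdry_bdry c.1) []
  · obtain ⟨f, -, σ, hσ, -⟩ := (inferInstance : Nonempty X.realization)
    obtain ⟨v, hv⟩ := X.nonempty_of_mem σ hσ
    intro (q : ℚ)
    refine ⟨⟨q • Finsupp.single [v] 1, Submodule.smul_mem _ _ (Finsupp.single_mem_supported _ _
      ⟨rfl, mem_faceLists_of_subset hσ (by simpa using hv)⟩)⟩, ?_⟩
    show bdry (q • Finsupp.single [v] (1 : ℚ)) [] = q
    rw [map_smul]
    simp
  · intro c hc
    have hd : bdry c.1 = 0 := by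
      rw [bdry_eq_of_mem_chains_zero c.2]
      exact (congrArg (Finsupp.single []) hc).trans (Finsupp.single_zero _)
    obtain ⟨b, hb, h⟩ := exists_bdry_eq_of_mem_chains hfd hcontr c.2 hd
    rw [chainComplex_d]
    exact ⟨⟨b, hb⟩, Subtype.ext h⟩
  · intro n c hc
    rw [chainComplex_d] at hc
    obtain ⟨b, hb, h⟩ := exists_bdry_eq_of_mem_chains hfd hcontr c.2 (congrArg Subtype.val hc)
    rw [chainComplex_d]
    exact ⟨⟨b, hb⟩, Subtype.ext h⟩
  · refine Rep.hom_ext ?_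
    ext c : 2
    show bdry (ListChain.antisymm c.1) [] = bdry c.1 []
    rw [bdry_antisymm, bdry_eq_of_mem_chains_zero c.2, ← mul_one (bdry c.1 []),
      ← smul_eq_mul, ← Finsupp.smul_single, map_smul, antisymm_nil]
  · refine Rep.hom_ext ?_
    ext c : 2
    exact Subtype.ext (antisymm_eq_zero_of_dim_lt hfd hm c.2)

end SComplex

namespace Rep

open CategoryTheory groupCohomology

theorem subsingleton_groupCohomology_of_shortExact {k G : Type} [CommRing k] [Group G]
    {S : ShortComplex (Rep.{0} k G)} (hS : S.ShortExact) (n : ℕ)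
    (h₂ : Subsingleton (groupCohomology S.X₂ n))
    (h₁ : Subsingleton (groupCohomology S.X₁ (n + 1))) :
    Subsingleton (groupCohomology S.X₃ n) := by
  have hex := mapShortComplex₃_exact hS (i := n) rfl
  rw [ShortComplex.moduleCat_exact_iff] at hex
  refine subsingleton_of_forall_eq 0 fun x => ?_
  obtain ⟨y, hy⟩ := hex x (@Subsingleton.elim _ h₁ _ _)
  rw [← hy, @Subsingleton.elim _ h₂ y 0]
  exact map_zero _

theorem subsingleton_groupCohomology_zero_iff {k G : Type} [CommRing k] [Group G]
    (A : Rep.{0} k G) : Subsingleton (groupCohomology A 0) ↔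
      ∀ f, inhomogeneousCochains.d A 0 f = 0 → f = 0 := by
  rw [← ModuleCat.isZero_iff_subsingleton, groupCohomology,
    ← HomologicalComplex.exactAt_iff_isZero_homology,
    HomologicalComplex.exactAt_iff' _ 0 0 1 (by simp) (by simp), ShortComplex.moduleCat_exact_iff]
  have hg : ((inhomogeneousCochains A).sc' 0 0 1).g = inhomogeneousCochains.d A 0 :=
    inhomogeneousCochains.d_def A 0
  have hf : ((inhomogeneousCochains A).sc' 0 0 1).f = 0 :=
    (inhomogeneousCochains A).shape 0 0 (by simp)
  rw [hg, hf]
  exact forall_congr' fun f => imp_congr_right fun _ => ⟨fun ⟨_, h⟩ => h.symm, fun h => ⟨0, h.symm⟩⟩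

theorem subsingleton_groupCohomology_succ_iff {k G : Type} [CommRing k] [Group G]
    (A : Rep.{0} k G) (n : ℕ) : Subsingleton (groupCohomology A (n + 1)) ↔
      ∀ f, inhomogeneousCochains.d A (n + 1) f = 0 → ∃ h, inhomogeneousCochains.d A n h = f := by
  rw [← ModuleCat.isZero_iff_subsingleton, groupCohomology,
    ← HomologicalComplex.exactAt_iff_isZero_homology,
    HomologicalComplex.exactAt_iff' _ n (n + 1) (n + 2) (by simp) (by simp),
    ShortComplex.moduleCat_exact_iff]
  have hg : ((inhomogeneousCochains A).sc' n (n + 1) (n + 2)).g =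
      inhomogeneousCochains.d A (n + 1) := inhomogeneousCochains.d_def A (n + 1)
  have hf : ((inhomogeneousCochains A).sc' n (n + 1) (n + 2)).f = inhomogeneousCochains.d A n :=
    inhomogeneousCochains.d_def A n
  rw [hg, hf]
  rfl

/-- Vanishing of group cohomology only depends on the underlying abelian group with `G`-action. -/
theorem subsingleton_groupCohomology_congr {k l G : Type} [CommRing k] [CommRing l] [Group G]
    (A : Rep.{0} k G) (B : Rep.{0} l G) (φ : A ≃+ B) (hφ : ∀ g a, φ (A.ρ g a) = B.ρ g (φ a))
    {n : ℕ} (h : Subsingleton (groupCohomology A n)) : Subsingleton (groupCohomology B n) := by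
  have key : ∀ n (f : (Fin n → G) → A), inhomogeneousCochains.d B n (φ ∘ f) =
      φ ∘ inhomogeneousCochains.d A n f := by
    intro n f
    have hs : ∀ (j : ℕ) (a : A), φ ((-1 : k) ^ j • a) = (-1 : l) ^ j • φ a := by
      intro j a
      rcases Nat.even_or_odd j with h | h <;> simp [h.neg_one_pow]
    funext g
    simp [inhomogeneousCochains.d_hom_apply, hφ, hs, map_sum]
  have key' : ∀ n (f : (Fin n → G) → B), inhomogeneousCochains.d B n f = 0 →
      inhomogeneousCochains.d A n (φ.symm ∘ f) = 0 := by
    intro n f hf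
    have : φ ∘ inhomogeneousCochains.d A n (φ.symm ∘ f) = 0 := by
      rw [← key, ← Function.comp_assoc]
      simpa using hf
    funext g
    exact φ.injective ((congrFun this g).trans (map_zero φ).symm)
  cases n with
  | zero =>
    rw [subsingleton_groupCohomology_zero_iff] at h ⊢
    intro f hf
    funext g
    exact φ.symm.injective ((congrFun (h _ (key' 0 f hf)) g).trans (map_zero φ.symm).symm)
  | succ n =>
    rw [subsingleton_groupCohomology_succ_iff] at h ⊢
    intro f hf
    obtain ⟨b, hb⟩ := h _ (key' _ f hf)
    refine ⟨φ ∘ b, ?_⟩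
    rw [key, hb, ← Function.comp_assoc]
    simp

/-- The standard basis of a free representation. -/
noncomputable def freeRepBasis (k G ι : Type) [CommRing k] [Group G] :
    Module.Basis (ι × G) k (freeRep k G ι) :=
  Module.Basis.ofRepr (MonoidAlgebra.coeffLinearEquiv k)

theorem freeRep_ρ_freeRepBasis {k G ι : Type} [CommRing k] [Group G] (g : G) (p : ι × G) :
    (freeRep k G ι).ρ g (freeRepBasis k G ι p) = freeRepBasis k G ι (p.1, g * p.2) := by
  let _ : MulAction G (ι × G) :=
    { smul := fun g p => (p.1, g * p.2)
      one_smul := fun p => by show (p.1, 1 * p.2) = p; simp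
      mul_smul := fun g h p => by
        show (p.1, g * h * p.2) = (p.1, g * (h * p.2)); rw [mul_assoc] }
  exact Representation.ofMulAction_single g p (1 : k)

/-- The morphism from a free representation with prescribed equivariant values on the basis. -/
noncomputable def freeRepLift {k G ι : Type} [CommRing k] [Group G] (A : Rep.{0} k G)
    (f : ι × G → A) (hf : ∀ g p, f (p.1, g * p.2) = A.ρ g (f p)) : freeRep k G ι ⟶ A :=
  Rep.ofHom ⟨(freeRepBasis k G ι).constr k f, fun g => by
    have : (freeRepBasis k G ι).constr k f ∘ₗ (freeRep k G ι).ρ g =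
        A.ρ g ∘ₗ (freeRepBasis k G ι).constr k f := (freeRepBasis k G ι).ext fun p => by
      simp [freeRep_ρ_freeRepBasis, hf]
    exact this⟩

@[simp]
theorem freeRepLift_freeRepBasis {k G ι : Type} [CommRing k] [Group G] (A : Rep.{0} k G)
    (f : ι × G → A) (hf : ∀ g p, f (p.1, g * p.2) = A.ρ g (f p)) (p : ι × G) :
    (freeRepLift A f hf).hom (freeRepBasis k G ι p) = f p :=
  (freeRepBasis k G ι).constr_basis k f p

/-- The canonical map from the free representation on the elements of `A`. -/
noncomputable def freeRepCover {k G : Type} [CommRing k] [Group G] (A : Rep.{0} k G) :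
    freeRep k G A ⟶ A :=
  freeRepLift A (fun p => A.ρ p.2 p.1) fun g p => by simp

theorem freeRepCover_surjective {k G : Type} [CommRing k] [Group G] (A : Rep.{0} k G) :
    Function.Surjective (freeRepCover A).hom := fun a =>
  ⟨freeRepBasis k G A (a, 1), by simp [freeRepCover]⟩

/-- In the top degree of cohomological dimension, cohomology is detected by free modules. -/
theorem subsingleton_groupCohomology_of_freeRep {k G : Type} [CommRing k] [Group G]
    (A : Rep.{0} k G) (n : ℕ)
    (h : ∀ K : Rep.{0} k G, Subsingleton (groupCohomology K (n + 1)))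
    (hF : Subsingleton (groupCohomology (freeRep k G A) n)) :
    Subsingleton (groupCohomology A n) := by
  let K := (freeRep k G A).subrepresentation (LinearMap.ker (freeRepCover A).hom.toLinearMap)
    fun g x hx => by
      show (freeRepCover A).hom ((freeRep k G A).ρ g x) = 0
      rw [hom_comm_apply]
      exact (congrArg _ hx).trans (map_zero _)
  let S : ShortComplex (Rep.{0} k G) := ShortComplex.mk (Rep.subtype (freeRep k G A) _ _ : K ⟶ _)
    (freeRepCover A) (by
      refine Rep.hom_ext ?_
      ext x : 2
      exact x.2)
  have hS : S.ShortExact :=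
    { exact := exact_of_forall_exists _ fun x hx => ⟨⟨x, hx⟩, rfl⟩
      mono_f := (Rep.mono_iff_injective _).2 Subtype.val_injective
      epi_g := (Rep.epi_iff_surjective _).2 (freeRepCover_surjective A) }
  exact subsingleton_groupCohomology_of_shortExact hS n hF (h _)

theorem not_subsingleton_groupCohomology_zero {k G : Type} [CommRing k] [Nontrivial k] [Group G] :
    ¬ Subsingleton (groupCohomology (Rep.trivial k G k) 0) := by
  rw [subsingleton_groupCohomology_zero_iff]
  intro h
  have := congrFun (h (fun _ => (1 : k)) ?_) (fun i => i.elim0)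
  · exact one_ne_zero this
  · funext g
    simp [inhomogeneousCochains.d_hom_apply]
    rfl

/-- The underlying integral representation of a rational representation. -/
noncomputable def restrictInt {G : Type} [Group G] (A : Rep.{0} ℚ G) : Rep.{0} ℤ G :=
  Rep.of (X := A)
    { toFun := fun g => (A.ρ g).toAddMonoidHom.toIntLinearMap
      map_one' := by ext; simp
      map_mul' := fun g h => by ext; simp }

section

variable (G ι : Type) [Group G]

/-- The relations between the generators `1 / n!` of the additive group of `ℚ`, induced up
to free representations. -/
noncomputable def factorialRel : freeRep ℤ G (ι × ℕ) ⟶ freeRep ℤ G (ι × ℕ) :=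
  freeRepLift _ (fun p => freeRepBasis ℤ G (ι × ℕ) p -
    ((p.1.2 + 1 : ℕ) : ℤ) • freeRepBasis ℤ G (ι × ℕ) ((p.1.1, p.1.2 + 1), p.2)) fun g p => by
    simp [freeRep_ρ_freeRepBasis]

/-- The free rational representation is generated over `ℤ` by the multiples by `1 / n!` of its
basis vectors. -/
noncomputable def factorialGen : freeRep ℤ G (ι × ℕ) ⟶ restrictInt (freeRep ℚ G ι) :=
  freeRepLift _ (fun p =>
    (((p.1.2).factorial : ℚ)⁻¹ • freeRepBasis ℚ G ι (p.1.1, p.2) : freeRep ℚ G ι)) fun g p => by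
    show (_ : freeRep ℚ G ι) = (freeRep ℚ G ι).ρ g _
    simp [freeRep_ρ_freeRepBasis]

variable {G ι}

theorem factorialGen_basis (p : (ι × ℕ) × G) :
    (factorialGen G ι).hom (freeRepBasis ℤ G (ι × ℕ) p) =
      (((p.1.2).factorial : ℚ)⁻¹ • freeRepBasis ℚ G ι (p.1.1, p.2) : freeRep ℚ G ι) :=
  freeRepLift_freeRepBasis ..

theorem factorialRel_basis (p : (ι × ℕ) × G) :
    (factorialRel G ι).hom (freeRepBasis ℤ G (ι × ℕ) p) = freeRepBasis ℤ G (ι × ℕ) p -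
    ((p.1.2 + 1 : ℕ) : ℤ) • freeRepBasis ℤ G (ι × ℕ) ((p.1.1, p.1.2 + 1), p.2) :=
  freeRepLift_freeRepBasis ..

theorem factorialRel_comp_factorialGen : factorialRel G ι ≫ factorialGen G ι = 0 := by
  have : (factorialGen G ι).hom.toLinearMap ∘ₗ (factorialRel G ι).hom.toLinearMap = 0 := by
    refine (freeRepBasis ℤ G (ι × ℕ)).ext fun p => ?_
    show (factorialGen G ι).hom ((factorialRel G ι).hom _) = 0
    rw [factorialRel_basis, map_sub, map_smul, factorialGen_basis, factorialGen_basis]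
    refine sub_eq_zero.2 ?_
    show (_ : freeRep ℚ G ι) = ((p.1.2 + 1 : ℕ) : ℤ) • (_ : freeRep ℚ G ι)
    rw [Nat.cast_smul_eq_nsmul ℤ, ← Nat.cast_smul_eq_nsmul ℚ, smul_smul, Nat.factorial_succ,
      Nat.cast_mul, mul_inv, mul_inv_cancel_left₀ (by positivity)]
  refine Rep.hom_ext ?_
  ext x : 2
  exact LinearMap.congr_fun this x

theorem factorialRel_injective : Function.Injective (factorialRel G ι).hom := by
  let b := freeRepBasis ℤ G (ι × ℕ)
  have h0 : ∀ x i g, b.repr ((factorialRel G ι).hom x) ((i, 0), g) = b.repr x ((i, 0), g) := by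
    intro x i g
    have : b.coord ((i, 0), g) ∘ₗ (factorialRel G ι).hom.toLinearMap = b.coord ((i, 0), g) := by
      refine b.ext fun p => ?_
      show b.coord _ ((factorialRel G ι).hom (b p)) = _
      rw [factorialRel_basis]
      simp [b]
    exact LinearMap.congr_fun this x
  have h1 : ∀ x i n g, b.repr ((factorialRel G ι).hom x) ((i, n + 1), g) =
      b.repr x ((i, n + 1), g) - (n + 1 : ℕ) * b.repr x ((i, n), g) := by
    intro x i n g
    have : b.coord ((i, n + 1), g) ∘ₗ (factorialRel G ι).hom.toLinearMap =
        b.coord ((i, n + 1), g) - ((n + 1 : ℕ) : ℤ) • b.coord ((i, n), g) := by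
      refine b.ext fun ⟨⟨j, m⟩, h⟩ => ?_
      show b.coord _ ((factorialRel G ι).hom (b _)) = _
      rw [factorialRel_basis]
      classical
      by_cases hm : m = n
      · subst hm
        by_cases hp : j = i ∧ h = g
        · simp [b, hp]
        · simp [b, hp]
      · simp [b, Finsupp.single_apply, hm]
    exact LinearMap.congr_fun this x
  rw [injective_iff_map_eq_zero]
  intro x hx
  have hz : ∀ n i g, b.repr x ((i, n), g) = 0 := by
    intro n
    induction n with
    | zero =>
      intro i g
      rw [← h0, hx]
      simp
    | succ n ih =>
      intro i g
      have := h1 x i n g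
      rw [hx, ih] at this
      simpa using this.symm
  exact b.repr.map_eq_zero_iff.1 (Finsupp.ext fun p => hz _ _ _)

theorem factorialGen_surjective : Function.Surjective (factorialGen G ι).hom := by
  let b := freeRepBasis ℚ G ι
  intro (x : freeRep ℚ G ι)
  have hx : b.repr.symm (b.repr x) = x := b.repr.symm_apply_apply x
  rw [← hx]
  generalize b.repr x = y
  induction y using Finsupp.induction_linear with
  | zero => exact ⟨0, by rw [map_zero]; exact (map_zero b.repr.symm).symm⟩
  | add u v hu hv =>
    obtain ⟨u', hu⟩ := hu
    obtain ⟨v', hv⟩ := hv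
    exact ⟨u' + v', by rw [map_add, hu, hv]; exact (map_add b.repr.symm _ _).symm⟩
  | single p q =>
    refine ⟨(q.num * ((q.den - 1).factorial : ℕ)) •
      freeRepBasis ℤ G (ι × ℕ) ((p.1, q.den), p.2), ?_⟩
    rw [map_smul, factorialGen_basis]
    show (q.num * ((q.den - 1).factorial : ℕ)) • (_ : freeRep ℚ G ι) = _
    rw [← Int.cast_smul_eq_zsmul ℚ, smul_smul, b.repr_symm_single]
    show _ • b p = q • b p
    congr 1
    obtain ⟨d, hd⟩ := Nat.exists_eq_succ_of_ne_zero q.den_nz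
    have : (q.num : ℚ) / q.den = q := Rat.num_div_den q
    rw [hd] at this ⊢
    refine Eq.trans ?_ this
    have := Nat.factorial_ne_zero d
    simp only [Nat.succ_eq_add_one, Nat.add_sub_cancel, Nat.factorial_succ]
    push_cast
    field_simp

theorem exists_factorialRel_eq (x : freeRep ℤ G (ι × ℕ)) (hx : (factorialGen G ι).hom x = 0) :
    ∃ y, (factorialRel G ι).hom y = x := by
  let b := freeRepBasis ℤ G (ι × ℕ)
  let c := freeRepBasis ℚ G ι
  let e : ℕ → (ι × G →₀ ℤ) →ₗ[ℤ] freeRep ℤ G (ι × ℕ) := fun N =>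
    Finsupp.linearCombination ℤ fun q => b ((q.1, N), q.2)
  have he : ∀ N q (r : ℤ), e N (Finsupp.single q r) = r • b ((q.1, N), q.2) := fun N q r =>
    Finsupp.linearCombination_single ..
  have hrange : ∀ y, ∃ N₀, ∀ N ≥ N₀, ∃ z, ∃ w, (factorialRel G ι).hom w = y - e N z := by
    intro y
    rw [← b.repr.symm_apply_apply y]
    generalize b.repr y = y
    induction y using Finsupp.induction_linear with
    | zero => exact ⟨0, fun N _ => ⟨0, 0, by simp⟩⟩
    | add u v hu hv =>
      obtain ⟨M, hM⟩ := hu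
      obtain ⟨N, hN⟩ := hv
      refine ⟨max M N, fun K hK => ?_⟩
      obtain ⟨z, w, h⟩ := hM K (le_trans (le_max_left _ _) hK)
      obtain ⟨z', w', h'⟩ := hN K (le_trans (le_max_right _ _) hK)
      refine ⟨z + z', w + w', ?_⟩
      rw [map_add, h, h', map_add, map_add]
      abel
    | single p r =>
      obtain ⟨⟨i, n⟩, g⟩ := p
      refine ⟨n, fun N hN => ?_⟩
      rw [b.repr_symm_single]
      induction N, hN using Nat.le_induction with
      | base => exact ⟨Finsupp.single (i, g) r, 0, by rw [he, map_zero]; exact (sub_self _).symm⟩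
      | succ N hN ih =>
        obtain ⟨z, w, h⟩ := ih
        have hstep : ∀ z, ∃ z' w, (factorialRel G ι).hom w = e N z - e (N + 1) z' := by
          intro z
          refine ⟨((N + 1 : ℕ) : ℤ) • z, e N z, ?_⟩
          have : (factorialRel G ι).hom.toLinearMap ∘ₗ e N =
              e N - ((N + 1 : ℕ) : ℤ) • e (N + 1) := by
            refine Finsupp.lhom_ext fun q r => ?_
            show (factorialRel G ι).hom (e N _) = e N _ - ((N + 1 : ℕ) : ℤ) • e (N + 1) _
            rw [he, he, map_smul, factorialRel_basis, smul_sub, smul_comm]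
          rw [map_smul]
          exact LinearMap.congr_fun this z
        obtain ⟨z', w', h'⟩ := hstep z
        exact ⟨z', w + w', by rw [map_add, h, h']; abel⟩
  obtain ⟨N, hN⟩ := hrange x
  obtain ⟨z, w, h⟩ := hN N le_rfl
  have hcomp : ∀ w, (factorialGen G ι).hom ((factorialRel G ι).hom w) = 0 := fun w =>
    LinearMap.congr_fun (congrArg (fun f => f.hom.toLinearMap) factorialRel_comp_factorialGen) w
  have hez : (factorialGen G ι).hom (e N z) = 0 := by
    have := hcomp w
    rw [h, map_sub, hx, zero_sub, neg_eq_zero] at this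
    exact this
  have hcoord : ∀ q (z : ι × G →₀ ℤ),
      c.repr ((factorialGen G ι).hom (e N z)) q = (N.factorial : ℚ)⁻¹ * z q := by
    intro q z
    induction z using Finsupp.induction_linear with
    | zero =>
      rw [map_zero, map_zero]
      exact (DFunLike.congr_fun (map_zero c.repr) q).trans (by simp)
    | add u v hu hv =>
      rw [map_add, map_add]
      refine (DFunLike.congr_fun (map_add c.repr _ _) q).trans ?_
      rw [Finsupp.add_apply, hu, hv]
      simp [mul_add]
    | single p r =>
      rw [he, map_smul, factorialGen_basis]
      show c.repr (r • (_ : freeRep ℚ G ι)) q = _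
      rw [← Int.cast_smul_eq_zsmul ℚ, smul_smul, map_smul, c.repr_self]
      by_cases hpq : p = q
      · subst hpq
        simp [mul_comm]
      · simp [hpq]
  have hz : z = 0 := by
    ext q
    have h0 : (0 : ℚ) = (N.factorial : ℚ)⁻¹ * z q := by
      rw [← hcoord q z, hez]
      exact (DFunLike.congr_fun (map_zero c.repr) q).symm
    have := Nat.factorial_ne_zero N
    simpa [this] using h0.symm
  exact ⟨w, by rw [h, hz, map_zero, sub_zero]⟩

/-- A free rational representation is, as an integral representation, the cokernel of an injective
morphism of free integral representations. -/
theorem subsingleton_groupCohomology_freeRep_rat (n : ℕ)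
    (h : Subsingleton (groupCohomology (freeRep ℤ G (ι × ℕ)) n))
    (h' : Subsingleton (groupCohomology (freeRep ℤ G (ι × ℕ)) (n + 1))) :
    Subsingleton (groupCohomology (freeRep ℚ G ι) n) := by
  let S := ShortComplex.mk (factorialRel G ι) (factorialGen G ι) factorialRel_comp_factorialGen
  have hS : S.ShortExact :=
    { exact := exact_of_forall_exists _ exists_factorialRel_eq
      mono_f := (Rep.mono_iff_injective _).2 factorialRel_injective
      epi_g := (Rep.epi_iff_surjective _).2 factorialGen_surjective }
  exact subsingleton_groupCohomology_congr (restrictInt (freeRep ℚ G ι)) (freeRep ℚ G ι)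
    (AddEquiv.refl _) (fun _ _ => rfl) (subsingleton_groupCohomology_of_shortExact hS n h h')

end

end Rep

/-- **Proposition (Osajda, Proposition 2.6, Leary).** If a group `G` acts with finite
stabilizers on a finite dimensional contractible simplicial complex `X` then:
(1) `cd_ℚ G ≤ dim X` (i.e. group cohomology over `ℚ` vanishes above `dim X`);
(2) there is a free `ℚG`-module `F = ⊕_ι ℚG` and `n' ≤ dim X` with `H^{n'}(G;F) ≠ 0`;
(3) there is a free `ℤG`-module `F̃ = ⊕_κ ℤG` and `n ∈ {n', n'+1}` with
`H^n(G;F̃) ≠ 0`. -/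
theorem cohomology_of_finite_stabilizers_action {V G : Type} [DecidableEq V]
    [Group G] [MulAction G V] (X : SComplex V)
    (hact : X.IsSimplicialAction G) (hstab : X.HasFiniteStabilizers G)
    (hfd : X.IsFiniteDimensional) (hcontr : ContractibleSpace X.realization) :
    (∀ (A : Rep ℚ G) (m : ℕ), X.dim < m → Subsingleton (groupCohomology A m)) ∧
    ∃ n' : ℕ, n' ≤ X.dim ∧
      (∃ ι : Type, Nontrivial (groupCohomology (freeRep ℚ G ι) n')) ∧
      (∃ (κ : Type) (n : ℕ), (n = n' ∨ n = n' + 1) ∧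
        Nontrivial (groupCohomology (freeRep ℤ G κ) n)) := by
  have hvanish := fun (A : Rep.{0} ℚ G) (m : ℕ) (hm : X.dim < m) =>
    SComplex.subsingleton_groupCohomology hact hstab hfd hcontr A hm
  refine ⟨hvanish, ?_⟩
  obtain ⟨n, hn, ⟨A, hA⟩, hmax⟩ : ∃ n ≤ X.dim,
      (∃ A : Rep.{0} ℚ G, ¬ Subsingleton (groupCohomology A n)) ∧
      ∀ K : Rep.{0} ℚ G, Subsingleton (groupCohomology K (n + 1)) := by
    classical
    let P : ℕ → Prop := fun n => ∃ A : Rep.{0} ℚ G, ¬ Subsingleton (groupCohomology A n)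
    have hP : P 0 := ⟨_, Rep.not_subsingleton_groupCohomology_zero⟩
    refine ⟨Nat.findGreatest P X.dim, Nat.findGreatest_le _,
      Nat.findGreatest_spec (Nat.zero_le _) hP, fun K => ?_⟩
    by_contra hK
    have hle : Nat.findGreatest P X.dim + 1 ≤ X.dim := by
      by_contra hlt
      exact hK (hvanish K _ (not_le.1 hlt))
    exact Nat.findGreatest_is_greatest (Nat.lt_succ_self _) hle ⟨K, hK⟩
  have hfree : ¬ Subsingleton (groupCohomology (freeRep ℚ G A) n) := fun h =>
    hA (Rep.subsingleton_groupCohomology_of_freeRep A n hmax h)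
  refine ⟨n, hn, ⟨A, not_subsingleton_iff_nontrivial.1 hfree⟩, A × ℕ, ?_⟩
  by_contra! h
  exact hfree (Rep.subsingleton_groupCohomology_freeRep_rat n (h n (Or.inl rfl))
    (h (n + 1) (Or.inr rfl)))
end

section
/- The universal cover of a 6-large chamber complex of dimension at least 1 is unbounded (with respect to the combinatorial distance on vertices). -/
universe u

/-- A simplicial covering map: a vertex map sending simplices injectively onto
simplices, surjective on simplices, with unique lifting of simplices at vertices. -/
def IsSimplicialCovering {V W : Type} [DecidableEq V] [DecidableEq W]
    (p : V → W) (X : SComplex V) (Y : SComplex W) : Prop :=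
  (∀ σ ∈ X.faces, σ.image p ∈ Y.faces ∧ Set.InjOn p (σ : Set V)) ∧
  (∀ τ ∈ Y.faces, ∃ σ ∈ X.faces, σ.image p = τ) ∧
  (∀ v : V, ({v} : Finset V) ∈ X.faces → ∀ τ ∈ Y.faces, p v ∈ τ →
    ∃! σ : Finset V, σ ∈ X.faces ∧ v ∈ σ ∧ σ.image p = τ)

/-- `p : X → Y` is the universal cover of `Y`: a simplicial covering with `X`
connected and simply connected. -/
def IsUniversalCover {V W : Type} [DecidableEq V] [DecidableEq W]
    (p : V → W) (X : SComplex V) (Y : SComplex W) : Prop :=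
  IsSimplicialCovering p X Y ∧ ConnectedSpace X.realization ∧
    SimplyConnectedSpace X.realization

/-- `π` is a covering of the graph `G` by the graph `H` that lifts triangles: it restricts to an
isomorphism between the subgraphs induced on closed neighbourhoods. -/
structure IsTriangleCover {Z V : Type*} (H : SimpleGraph Z) (G : SimpleGraph V) (π : Z → V) :
    Prop where
  map_adj : ∀ {z z'}, H.Adj z z' → G.Adj (π z) (π z')
  exists_lift : ∀ {z y}, G.Adj (π z) y → ∃ z', H.Adj z z' ∧ π z' = y
  lift_unique : ∀ {z z₁ z₂}, H.Adj z z₁ → H.Adj z z₂ → π z₁ = π z₂ → z₁ = z₂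
  adj_of_adj : ∀ {z z₁ z₂}, H.Adj z z₁ → H.Adj z z₂ → G.Adj (π z₁) (π z₂) → H.Adj z₁ z₂

namespace SComplex

/-- The 1-skeleton of a simplicial complex. -/
def edgeGraph {V : Type*} [DecidableEq V] (X : SComplex V) : SimpleGraph V where
  Adj a b := a ≠ b ∧ ({a, b} : Finset V) ∈ X.faces
  symm := ⟨fun a b h => ⟨h.1.symm, Finset.pair_comm a b ▸ h.2⟩⟩
  loopless := ⟨fun _ h => h.1 rfl⟩

lemma edgeGraph_adj {V : Type*} [DecidableEq V] {X : SComplex V} {a b : V} :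
    X.edgeGraph.Adj a b ↔ a ≠ b ∧ ({a, b} : Finset V) ∈ X.faces := Iff.rfl

section CoverSpace

variable {V Z : Type*} {X : SComplex V} {H : SimpleGraph Z} {π : Z → V}

open Classical in
/-- The lift of the function `f` to the closed star of `z`, extended by zero. -/
noncomputable def spread (H : SimpleGraph Z) (π : Z → V) (f : V → ℝ) (z : Z) : Z → ℝ :=
  fun w => if w = z ∨ H.Adj z w then f (π w) else 0

lemma spread_self (f : V → ℝ) (z : Z) : spread H π f z z = f (π z) := by simp [spread]

lemma spread_pos {f : V → ℝ} {z w : Z} (h : 0 < spread H π f z w) :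
    (w = z ∨ H.Adj z w) ∧ 0 < f (π w) := by
  unfold spread at h
  split_ifs at h with hw
  · exact ⟨hw, h⟩
  · exact absurd h (lt_irrefl _)

variable (X H π) in
/-- The total space of the covering of the realization of `X` induced by `π`. -/
def CoverSpace : Type _ :=
  {e : X.realization × (Z → ℝ) // ∃ z, 0 < e.1.1 (π z) ∧ e.2 = spread H π e.1.1 z}

instance : TopologicalSpace (CoverSpace X H π) :=
  instTopologicalSpaceSubtype

/-- The projection of the covering space to the realization. -/
def CoverSpace.proj (e : CoverSpace X H π) : X.realization := e.1.1

lemma CoverSpace.continuous_proj : Continuous (CoverSpace.proj : CoverSpace X H π → _) :=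
  continuous_fst.comp continuous_subtype_val

lemma exists_pos_of_realization {f : V → ℝ} (hf : f ∈ X.realization) : ∃ v, 0 < f v := by
  obtain ⟨h0, σ, -, -, h1⟩ := hf
  by_contra! h
  have : ∑ v ∈ σ, f v = 0 := Finset.sum_eq_zero fun v _ => le_antisymm (h v) (h0 v)
  linarith

end CoverSpace

section TriangleCover

variable {V Z : Type*} [DecidableEq V] {X : SComplex V} {H : SimpleGraph Z} {π : Z → V}

lemma eq_or_adj_of_mem {σ : Finset V} (hσ : σ ∈ X.faces) {a b : V} (ha : a ∈ σ) (hb : b ∈ σ) :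
    a = b ∨ X.edgeGraph.Adj a b := by
  by_cases h : a = b
  · exact .inl h
  · refine .inr <| edgeGraph_adj.2 ⟨h, X.down_closed σ hσ _ ?_ (by simp)⟩
    simp [Finset.insert_subset_iff, ha, hb]

lemma eq_or_adj_of_realization {f : V → ℝ} (hf : f ∈ X.realization) {a b : V} (ha : f a ≠ 0)
    (hb : f b ≠ 0) : a = b ∨ X.edgeGraph.Adj a b := by
  obtain ⟨-, σ, hσ, h0, -⟩ := hf
  exact eq_or_adj_of_mem hσ (by_contra fun h => ha (h0 _ h)) (by_contra fun h => hb (h0 _ h))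

lemma spread_congr (hc : IsTriangleCover H X.edgeGraph π) {f : V → ℝ} {z z' : Z}
    (hz : z' = z ∨ H.Adj z z')
    (h : ∀ v, f v ≠ 0 → π z = v ∨ X.edgeGraph.Adj (π z) v)
    (h' : ∀ v, f v ≠ 0 → π z' = v ∨ X.edgeGraph.Adj (π z') v) :
    spread H π f z = spread H π f z' := by
  rcases hz with rfl | hz
  · rfl
  have key : ∀ {a b w : Z}, H.Adj a b → (π b = π w ∨ X.edgeGraph.Adj (π b) (π w)) →
      (w = a ∨ H.Adj a w) → (w = b ∨ H.Adj b w) := by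
    rintro a b w hab hb (rfl | hw)
    · exact .inr hab.symm
    · rcases hb with hb | hb
      · exact .inl (hc.lift_unique hw hab hb.symm)
      · exact .inr (hc.adj_of_adj hab hw hb)
  ext w
  by_cases hw : f (π w) = 0
  · simp [spread, hw]
  · have : (w = z ∨ H.Adj z w) ↔ (w = z' ∨ H.Adj z' w) :=
      ⟨key hz (h' _ hw), key hz.symm (h _ hw)⟩
    simp only [spread]
    split_ifs <;> tauto

lemma CoverSpace.existsUnique_sheet (hc : IsTriangleCover H X.edgeGraph π) (e : CoverSpace X H π)
    {v : V} (hv : 0 < e.proj.1 v) : ∃! z, π z = v ∧ 0 < e.1.2 z := by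
  obtain ⟨⟨f, g⟩, z, hz, hg⟩ := e
  change 0 < f.1 v at hv
  dsimp only at hz hg ⊢
  subst hg
  have hex : ∃ w, (w = z ∨ H.Adj z w) ∧ π w = v := by
    rcases eq_or_adj_of_realization f.2 hz.ne' hv.ne' with h | h
    · exact ⟨z, .inl rfl, h⟩
    · obtain ⟨w, hw, hw'⟩ := hc.exists_lift h
      exact ⟨w, .inr hw, hw'⟩
  obtain ⟨w, hw, rfl⟩ := hex
  refine ⟨w, ⟨rfl, by simpa [spread, hw] using hv⟩, ?_⟩
  rintro w' ⟨hw', hpos⟩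
  rcases (spread_pos hpos).1 with rfl | h <;> rcases hw with rfl | h'
  · rfl
  · exact absurd hw' (hc.map_adj h').ne
  · exact absurd hw'.symm (hc.map_adj h).ne
  · exact hc.lift_unique h h' hw'

lemma CoverSpace.spread_eq (hc : IsTriangleCover H X.edgeGraph π) (e : CoverSpace X H π) {z : Z}
    (hz : 0 < e.1.2 z) : e.1.2 = spread H π e.proj.1 z := by
  obtain ⟨⟨f, g⟩, w, hw, hg⟩ := e
  dsimp only at hw hg hz
  subst hg
  obtain ⟨h, hpos⟩ := spread_pos hz
  exact spread_congr hc h (fun v hv => eq_or_adj_of_realization f.2 hw.ne' hv)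
    (fun v hv => eq_or_adj_of_realization f.2 hpos.ne' hv)

theorem CoverSpace.isCoveringMap (hc : IsTriangleCover H X.edgeGraph π) :
    IsCoveringMap (CoverSpace.proj : CoverSpace X H π → X.realization) := by
  intro x
  obtain ⟨v, hv⟩ := exists_pos_of_realization x.2
  let I := {z : Z // π z = v}
  let _ : TopologicalSpace I := ⊥
  have : DiscreteTopology I := ⟨rfl⟩
  have hU : IsOpen {f : X.realization | 0 < f.1 v} :=
    isOpen_lt continuous_const ((continuous_apply v).comp continuous_subtype_val)
  refine IsEvenlyCovered.to_isEvenlyCovered_preimage (I := I)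
    ⟨inferInstance, {f | 0 < f.1 v}, hv, hU, hU.preimage continuous_proj, ?_⟩
  choose s hs hs' using fun e :
      CoverSpace.proj (H := H) (π := π) ⁻¹' {f : X.realization | 0 < f.1 v} =>
    (e.1.existsUnique_sheet hc e.2)
  dsimp only at hs hs'
  refine ⟨⟨⟨fun e => (⟨e.1.proj, e.2⟩, ⟨s e, (hs e).1⟩), fun q =>
    ⟨⟨(q.1.1, spread H π q.1.1.1 q.2.1), q.2.1, by rw [q.2.2]; exact q.1.2, rfl⟩, q.1.2⟩,
    fun e => ?_, fun q => ?_⟩, ?_, ?_⟩, fun _ => rfl⟩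
  · refine Subtype.ext (Subtype.ext (Prod.ext rfl ?_))
    exact (e.1.spread_eq hc (hs e).2).symm
  · refine Prod.ext rfl (Subtype.ext ?_)
    refine (hs' _ _ ⟨q.2.2, ?_⟩).symm
    change 0 < spread H π q.1.1.1 q.2.1 q.2.1
    rw [spread_self, q.2.2]
    exact q.1.2
  · refine ((continuous_proj.comp continuous_subtype_val).subtype_mk _).prodMk
      (continuous_discrete_rng.2 fun z => ?_)
    have : (fun e => (⟨s e, (hs e).1⟩ : I)) ⁻¹' {z} = {e | 0 < e.1.1.2 z.1} := by
      ext e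
      constructor
      · rintro rfl
        exact (hs e).2
      · exact fun h => Subtype.ext (hs' e z.1 ⟨z.2, h⟩).symm
    rw [this]
    exact isOpen_lt continuous_const ((continuous_apply z.1).comp
      (continuous_snd.comp (continuous_subtype_val.comp continuous_subtype_val)))
  · refine continuous_prod_of_discrete_right.2 fun z => ?_
    refine (Continuous.subtype_mk (continuous_subtype_val.prodMk (continuous_pi fun w => ?_))
      _).subtype_mk _
    by_cases hw : w = z.1 ∨ H.Adj z.1 w <;> simp only [spread, hw, if_true, if_false]
    · exact (continuous_apply _).comp (continuous_subtype_val.comp continuous_subtype_val)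
    · exact continuous_const

lemma eq_of_joined_of_isCoveringMap {E B : Type*} [TopologicalSpace E] [TopologicalSpace B]
    [SimplyConnectedSpace B] {q : E → B} (hq : IsCoveringMap q) {e e' : E} (h : Joined e e')
    (hqe : q e = q e') : e = e' := by
  obtain ⟨γ⟩ := h
  let δ : Path (q e) (q e) := (γ.map hq.continuous).cast rfl hqe
  have hδ : δ.toContinuousMap.HomotopicRel (Path.refl (q e)).toContinuousMap {0, 1} :=
    SimplyConnectedSpace.paths_homotopic δ (Path.refl _)
  have h := hq.liftPath_apply_one_eq_of_homotopicRel hδ e (by simp) (by simp)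
  have h₁ : γ.toContinuousMap = hq.liftPath δ.toContinuousMap e (by simp) :=
    (hq.eq_liftPath_iff' _).2 ⟨by ext; rfl, γ.source⟩
  have h₂ : ContinuousMap.const _ e = hq.liftPath (Path.refl (q e)).toContinuousMap e (by simp) :=
    (hq.eq_liftPath_iff' _).2 ⟨by ext; rfl, rfl⟩
  rw [← h₁, ← h₂] at h
  simpa using h.symm

/-- The point of the segment from the vertex `a` to the vertex `b` with parameter `t`. -/
lemma segment_mem_realization {a b : V} (h : X.edgeGraph.Adj a b) (t : unitInterval) :
    (fun v => (1 - t : ℝ) * Pi.single (M := fun _ => ℝ) a 1 v +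
      t * Pi.single (M := fun _ => ℝ) b 1 v) ∈
      X.realization := by
  obtain ⟨hne, hab⟩ := edgeGraph_adj.1 h
  refine ⟨fun v => add_nonneg (mul_nonneg (sub_nonneg.2 t.2.2) ?_) (mul_nonneg t.2.1 ?_),
    {a, b}, hab, fun v hv => ?_, ?_⟩
  · by_cases hv : v = a <;> simp [hv]
  · by_cases hv : v = b <;> simp [hv]
  · simp only [Finset.mem_insert, Finset.mem_singleton, not_or] at hv
    simp [hv.1, hv.2]
  · rw [Finset.sum_pair hne]
    simp [hne, hne.symm]

lemma single_mem_realization {a : V} (h : ({a} : Finset V) ∈ X.faces) :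
    (Pi.single a 1 : V → ℝ) ∈ X.realization := by
  refine ⟨fun v => ?_, {a}, h, fun v hv => ?_, by simp⟩
  · by_cases hv : v = a <;> simp [hv]
  · simp only [Finset.mem_singleton] at hv
    simp [hv]

/-- The point of the covering space given by a vertex of the covering graph. -/
noncomputable def CoverSpace.vertex (z : Z) (h : ({π z} : Finset V) ∈ X.faces) :
    CoverSpace X H π :=
  ⟨(⟨Pi.single (π z) 1, single_mem_realization h⟩, spread H π (Pi.single (π z) 1) z), z,
    by simp, rfl⟩

lemma CoverSpace.joined_vertex_of_adj (hc : IsTriangleCover H X.edgeGraph π) {z z' : Z}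
    (hz : H.Adj z z') (h : ({π z} : Finset V) ∈ X.faces) (h' : ({π z'} : Finset V) ∈ X.faces) :
    Joined (vertex z h : CoverSpace X H π) (vertex z' h') := by
  have hadj := hc.map_adj hz
  have key : ∀ f : V → ℝ, (∀ v, v ≠ π z → v ≠ π z' → f v = 0) →
      spread H π f z = spread H π f z' := by
    intro f hf
    have hf' : ∀ v, f v ≠ 0 → v = π z ∨ v = π z' := fun v hv => by
      by_contra! hcon
      exact hv (hf v hcon.1 hcon.2)
    refine spread_congr hc (.inr hz) (fun v hv => ?_) (fun v hv => ?_)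
    · rcases hf' v hv with rfl | rfl
      exacts [.inl rfl, .inr hadj]
    · rcases hf' v hv with rfl | rfl
      exacts [.inr hadj.symm, .inl rfl]
  let F : unitInterval → V → ℝ := fun t v => (1 - t : ℝ) * Pi.single (M := fun _ => ℝ) (π z) 1 v +
    t * Pi.single (M := fun _ => ℝ) (π z') 1 v
  have hF : ∀ t v, v ≠ π z → v ≠ π z' → F t v = 0 := fun t v h₁ h₂ => by
    simp [F, Pi.single_apply, h₁, h₂]
  have hFc : ∀ v, Continuous fun t => F t v := fun v => by
    simp only [F]
    fun_prop
  have hF0 : F 0 = Pi.single (π z) 1 := by ext v; simp [F]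
  have hF1 : F 1 = Pi.single (π z') 1 := by ext v; simp [F]
  refine ⟨⟨⟨fun t => ⟨(⟨F t, segment_mem_realization hadj t⟩, spread H π (F t) z), ?_⟩, ?_⟩,
    ?_, ?_⟩⟩
  · by_cases ht : (t : ℝ) < 1
    · refine ⟨z, ?_, rfl⟩
      simp [F, Pi.single_apply, hadj.ne, ht]
    · have ht : (t : ℝ) = 1 := le_antisymm t.2.2 (not_lt.1 ht)
      refine ⟨z', ?_, key _ (hF t)⟩
      simp [F, Pi.single_apply, hadj.ne', ht]
  · refine Continuous.subtype_mk (Continuous.prodMk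
      ((continuous_pi hFc).subtype_mk _) (continuous_pi fun w => ?_)) _
    unfold spread
    split_ifs
    · exact hFc _
    · exact continuous_const
  · refine Subtype.ext (Prod.ext (Subtype.ext hF0) ?_)
    simp only [hF0]
    rfl
  · refine Subtype.ext (Prod.ext (Subtype.ext hF1) ?_)
    exact (key _ (hF 1)).trans (by rw [hF1]; rfl)

theorem eq_of_reachable [SimplyConnectedSpace X.realization]
    (hc : IsTriangleCover H X.edgeGraph π) {z z' : Z} (hz : ({π z} : Finset V) ∈ X.faces)
    (hr : H.Reachable z z') (h : π z = π z') : z = z' := by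
  have hj : ∀ hz' : ({π z'} : Finset V) ∈ X.faces,
      Joined (CoverSpace.vertex z hz : CoverSpace X H π) (CoverSpace.vertex z' hz') := by
    obtain ⟨w⟩ := hr
    clear h
    induction w with
    | nil => exact fun _ => Joined.refl _
    | @cons a b c hab _ ih =>
      have hb : ({π b} : Finset V) ∈ X.faces :=
        X.down_closed _ (edgeGraph_adj.1 (hc.map_adj hab)).2 _ (by simp) (by simp)
      exact fun hz' => (CoverSpace.joined_vertex_of_adj hc hab hz hb).trans (ih hb hz')
  have he := eq_of_joined_of_isCoveringMap (CoverSpace.isCoveringMap hc) (hj (h ▸ hz))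
    (Subtype.ext (by simp [CoverSpace.vertex, CoverSpace.proj, h]))
  have hpos : 0 < spread H π (Pi.single (π z') 1 : V → ℝ) z' z := by
    have : spread H π (Pi.single (π z) 1 : V → ℝ) z = spread H π (Pi.single (π z') 1) z' :=
      congrArg (fun e => e.1.2) he
    rw [← this, spread_self]
    simp
  rcases (spread_pos hpos).1 with h' | h'
  · exact h'
  · exact absurd h.symm (hc.map_adj h').ne

end TriangleCover

end SComplex

namespace SimpleGraph

variable {W : Type} {G : SimpleGraph W}

/-- A graph without induced cycles of length four or five. -/
structure IsSixLarge (G : SimpleGraph W) : Prop where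
  four : ∀ {a b c d}, G.Adj a b → G.Adj b c → G.Adj c d → G.Adj d a → a ≠ c → b ≠ d →
    G.Adj a c ∨ G.Adj b d
  five : ∀ {a b c d e}, G.Adj a b → G.Adj b c → G.Adj c d → G.Adj d e → G.Adj e a →
    a ≠ c → a ≠ d → b ≠ d → b ≠ e → c ≠ e →
    G.Adj a c ∨ G.Adj a d ∨ G.Adj b d ∨ G.Adj b e ∨ G.Adj c e

/-- A sphere in a covering of `G`: its points `carrier` with their images `proj` in `G`, the graph
`adj` induced on it, and for every point the images `lower` of its neighbours in the preceding
sphere. -/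
structure Layer (G : SimpleGraph W) where
  carrier : Type
  proj : carrier → W
  adj : SimpleGraph carrier
  lower : carrier → Set W
  map_adj : ∀ {s t}, adj.Adj s t → G.Adj (proj s) (proj t)
  proj_inj : ∀ {s t r}, adj.Adj s t → adj.Adj s r → proj t = proj r → t = r
  adj_of_adj : ∀ {s t r}, adj.Adj s t → adj.Adj s r → G.Adj (proj t) (proj r) → adj.Adj t r
  adj_of_mem_lower : ∀ {s w}, w ∈ lower s → G.Adj (proj s) w
  lower_clique : ∀ {s w w'}, w ∈ lower s → w' ∈ lower s → w ≠ w' → G.Adj w w'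
  exists_mem_lower : ∀ {s t}, adj.Adj s t → ∃ w, w ∈ lower s ∧ w ∈ lower t
  proj_notMem_lower : ∀ {s t}, adj.Adj s t → proj t ∉ lower s
  mem_lower_of_adj : ∀ {s t w}, adj.Adj s t → w ∈ lower s → G.Adj w (proj t) → w ∈ lower t
  neighbor_of_mem_lower : ∀ {s w y}, w ∈ lower s → G.Adj w y → G.Adj (proj s) y →
    y ∈ lower s ∨ ∃ t, adj.Adj s t ∧ proj t = y

namespace Layer

/-- The vertex `x` is the image of a neighbour of `s` in the following sphere. -/
def IsUpper (P : Layer G) (s : P.carrier) (x : W) : Prop :=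
  G.Adj (P.proj s) x ∧ x ∉ P.lower s ∧ ∀ t, P.adj.Adj s t → P.proj t ≠ x

variable {P : Layer G} {s t r : P.carrier} {x y w : W}

lemma IsUpper.not_adj_lower (hx : P.IsUpper s x) (hw : w ∈ P.lower s) : ¬ G.Adj x w := by
  intro h
  rcases P.neighbor_of_mem_lower hw h.symm hx.1 with h' | ⟨t, ht, rfl⟩
  · exact hx.2.1 h'
  · exact hx.2.2 t ht rfl

lemma IsUpper.ne_lower (hx : P.IsUpper s x) (hw : w ∈ P.lower s) : x ≠ w := by
  rintro rfl
  exact hx.2.1 hw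

lemma IsUpper.of_adj (hx : P.IsUpper s x) (h : P.adj.Adj s t) (hxt : G.Adj (P.proj t) x) :
    P.IsUpper t x := by
  refine ⟨hxt, fun hm => hx.2.1 (P.mem_lower_of_adj h.symm hm hx.1.symm), ?_⟩
  rintro r hr rfl
  exact hx.2.2 r (P.adj_of_adj h.symm hr hx.1) rfl

lemma IsUpper.adj_trans (hG : G.IsSixLarge) (hs : P.IsUpper s x) (hr : P.IsUpper r x)
    (hst : P.adj.Adj s t) (htr : P.adj.Adj t r) (hsr : s ≠ r) : P.adj.Adj s r := by
  refine P.adj_of_adj hst.symm htr ?_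
  have hne : P.proj s ≠ P.proj r := fun h => hsr (P.proj_inj hst.symm htr h)
  have key : ∀ {w}, w ∈ P.lower s → w ∈ P.lower r → G.Adj (P.proj s) (P.proj r) := by
    intro w hws hwr
    refine (hG.four hs.1.symm (P.adj_of_mem_lower hws) (P.adj_of_mem_lower hwr).symm hr.1
      (hs.ne_lower hws) hne).resolve_left (hs.not_adj_lower hws)
  obtain ⟨w, hws, hwt⟩ := P.exists_mem_lower hst
  obtain ⟨w', hwt', hwr'⟩ := P.exists_mem_lower htr
  by_cases h₁ : w ∈ P.lower r
  · exact key hws h₁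
  by_cases h₂ : w' ∈ P.lower s
  · exact key h₂ hwr'
  have hww : w ≠ w' := by
    rintro rfl
    exact h₁ hwr'
  have n₁ : ¬ G.Adj w (P.proj r) := fun h => h₁ (P.mem_lower_of_adj htr hwt h)
  have n₂ : ¬ G.Adj w' (P.proj s) := fun h => h₂ (P.mem_lower_of_adj hst.symm hwt' h)
  rcases hG.five hs.1.symm (P.adj_of_mem_lower hws) (P.lower_clique hwt hwt' hww)
    (P.adj_of_mem_lower hwr').symm hr.1 (hs.ne_lower hws) (hr.ne_lower hwr')
    (fun h => P.proj_notMem_lower hst.symm (h ▸ hwt')) hne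
    (fun h => P.proj_notMem_lower htr (h ▸ hwt)) with h | h | h | h | h
  · exact absurd h (hs.not_adj_lower hws)
  · exact absurd h (hr.not_adj_lower hwr')
  · exact absurd h.symm n₂
  · exact h
  · exact absurd h n₁

/-- Two pairs, of a point and the image of an upper neighbour of it, give the same point of the
following sphere. -/
def nextSetoid (hG : G.IsSixLarge) (P : Layer G) :
    Setoid {q : P.carrier × W // P.IsUpper q.1 q.2} where
  r a b := a.1.2 = b.1.2 ∧ (a.1.1 = b.1.1 ∨ P.adj.Adj a.1.1 b.1.1)
  iseqv := by
    refine ⟨fun a => ⟨rfl, .inl rfl⟩, fun h => ⟨h.1.symm, h.2.imp Eq.symm SimpleGraph.Adj.symm⟩, ?_⟩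
    rintro ⟨⟨s, x⟩, hs⟩ ⟨⟨t, y⟩, ht⟩ ⟨⟨r, z⟩, hr⟩ ⟨rfl, hst⟩ ⟨rfl, htr⟩
    dsimp only at *
    refine ⟨rfl, ?_⟩
    rcases hst with rfl | hst
    · exact htr
    rcases htr with rfl | htr
    · exact .inr hst
    by_cases hsr : s = r
    · exact .inl hsr
    · exact .inr (hs.adj_trans hG hr hst htr hsr)

variable (hG : G.IsSixLarge)

/-- The points of the sphere following `P`. -/
def NextCarrier (hG : G.IsSixLarge) (P : Layer G) : Type := Quotient (P.nextSetoid hG)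

/-- The image in `G` of a point of the following sphere. -/
def nextProj (hG : G.IsSixLarge) (P : Layer G) : P.NextCarrier hG → W :=
  Quotient.lift (fun a => a.1.2) fun _ _ h => h.1

/-- The point `s` of `P` is adjacent to the point `q` of the following sphere. -/
def Below (hG : G.IsSixLarge) (s : P.carrier) (q : P.NextCarrier hG) : Prop :=
  ∃ x, ∃ h : P.IsUpper s x, q = Quotient.mk (P.nextSetoid hG) ⟨(s, x), h⟩

variable {hG} {q q' : P.NextCarrier hG}

lemma exists_below (q : P.NextCarrier hG) : ∃ s, Below hG s q := by
  induction q using Quotient.ind with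
  | _ a => exact ⟨a.1.1, a.1.2, a.2, rfl⟩

lemma Below.isUpper (h : Below hG s q) : P.IsUpper s (P.nextProj hG q) := by
  obtain ⟨x, hx, rfl⟩ := h
  exact hx

lemma Below.adj (h : Below hG s q) : G.Adj (P.proj s) (P.nextProj hG q) := h.isUpper.1

lemma IsUpper.exists_below (h : P.IsUpper s x) : ∃ q, Below hG s q ∧ P.nextProj hG q = x :=
  ⟨Quotient.mk (P.nextSetoid hG) ⟨(s, x), h⟩, ⟨x, h, rfl⟩, rfl⟩

lemma Below.eq_or_adj (hs : Below hG s q) (ht : Below hG t q) : s = t ∨ P.adj.Adj s t := by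
  obtain ⟨x, hx, rfl⟩ := hs
  obtain ⟨y, hy, h⟩ := ht
  exact (Quotient.exact h).2

lemma Below.eq_of_proj_eq (hs : Below hG s q) (ht : Below hG t q') (hst : s = t ∨ P.adj.Adj s t)
    (h : P.nextProj hG q = P.nextProj hG q') : q = q' := by
  obtain ⟨x, hx, rfl⟩ := hs
  obtain ⟨y, hy, rfl⟩ := ht
  exact Quotient.sound ⟨h, hst⟩

lemma Below.of_adj (hs : Below hG s q) (h : P.adj.Adj s t)
    (hadj : G.Adj (P.proj t) (P.nextProj hG q)) : Below hG t q := by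
  obtain ⟨q', hq', hp⟩ := (hs.isUpper.of_adj h hadj).exists_below (hG := hG)
  rwa [hs.eq_of_proj_eq hq' (.inr h) hp.symm]

/-- The graph on the sphere following `P`. -/
def nextAdj (hG : G.IsSixLarge) (P : Layer G) : SimpleGraph (P.NextCarrier hG) where
  Adj q q' := (∃ s, Below hG s q ∧ Below hG s q') ∧ G.Adj (P.nextProj hG q) (P.nextProj hG q')
  symm := ⟨fun _ _ h => ⟨h.1.imp fun _ h => h.symm, h.2.symm⟩⟩
  loopless := ⟨fun _ h => h.2.ne rfl⟩

lemma Below.of_nextAdj (hs : Below hG s q) (h : (P.nextAdj hG).Adj q q')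
    (hadj : G.Adj (P.proj s) (P.nextProj hG q')) : Below hG s q' := by
  obtain ⟨⟨t, htq, htq'⟩, -⟩ := h
  rcases htq.eq_or_adj hs with rfl | hts
  · exact htq'
  · exact htq'.of_adj hts hadj

/-- The sphere following `P`. -/
def next (hG : G.IsSixLarge) (P : Layer G) : Layer G where
  carrier := P.NextCarrier hG
  proj := P.nextProj hG
  adj := P.nextAdj hG
  lower q := {w | ∃ s, Below hG s q ∧ P.proj s = w}
  map_adj h := h.2
  proj_inj := by
    rintro q q₁ q₂ ⟨⟨s, hs, hs₁⟩, h₁⟩ ⟨⟨t, ht, ht₂⟩, h₂⟩ h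
    exact hs₁.eq_of_proj_eq ht₂ (hs.eq_or_adj ht) h
  adj_of_adj := by
    rintro q q₁ q₂ ⟨⟨s, hs, hs₁⟩, h₁⟩ ⟨⟨t, ht, ht₂⟩, h₂⟩ h
    refine ⟨?_, h⟩
    rcases hs.eq_or_adj ht with rfl | hst
    · exact ⟨s, hs₁, ht₂⟩
    rcases hG.four hs₁.adj.symm (P.map_adj hst) ht₂.adj h.symm
      (fun h => hs₁.isUpper.2.2 t hst h.symm) (fun h => ht₂.isUpper.2.2 s hst.symm h) with h | h
    · exact ⟨t, hs₁.of_adj hst h.symm, ht₂⟩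
    · exact ⟨s, hs₁, ht₂.of_adj hst.symm h⟩
  adj_of_mem_lower := by
    rintro q _ ⟨s, hs, rfl⟩
    exact hs.adj.symm
  lower_clique := by
    rintro q _ _ ⟨s, hs, rfl⟩ ⟨t, ht, rfl⟩ hne
    exact P.map_adj ((hs.eq_or_adj ht).resolve_left fun h => hne (h ▸ rfl))
  exists_mem_lower := by
    rintro q q' ⟨⟨s, hs, hs'⟩, -⟩
    exact ⟨P.proj s, ⟨s, hs, rfl⟩, ⟨s, hs', rfl⟩⟩
  proj_notMem_lower := by
    rintro q q' ⟨⟨s, hs, hs'⟩, -⟩ ⟨t, ht, h⟩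
    rcases hs.eq_or_adj ht with rfl | hst
    · exact hs'.adj.ne h
    · exact hs'.isUpper.2.2 t hst h
  mem_lower_of_adj := by
    rintro q q' _ h ⟨s, hs, rfl⟩ hadj
    exact ⟨s, hs.of_nextAdj h hadj, rfl⟩
  neighbor_of_mem_lower := by
    rintro q _ y ⟨s, hs, rfl⟩ hy hqy
    by_cases hu : P.IsUpper s y
    · obtain ⟨q', hq', rfl⟩ := hu.exists_below (hG := hG)
      exact .inr ⟨q', ⟨⟨s, hs, hq'⟩, hqy⟩, rfl⟩
    · have hl : y ∉ P.lower s := fun hl => hs.isUpper.not_adj_lower hl hqy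
      have : ∃ t, P.adj.Adj s t ∧ P.proj t = y := by
        by_contra! hcon
        exact hu ⟨hy, hl, hcon⟩
      obtain ⟨t, ht, rfl⟩ := this
      exact .inl ⟨t, hs.of_adj ht hqy.symm, rfl⟩

/-- The sphere of radius zero. -/
def base (G : SimpleGraph W) (u : W) : Layer G where
  carrier := Unit
  proj _ := u
  adj := ⊥
  lower _ := ∅
  map_adj h := h.elim
  proj_inj h := h.elim
  adj_of_adj h := h.elim
  adj_of_mem_lower h := h.elim
  lower_clique h := h.elim
  exists_mem_lower h := h.elim
  proj_notMem_lower h := h.elim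
  mem_lower_of_adj h := h.elim
  neighbor_of_mem_lower h := h.elim

end Layer

/-- The spheres around a point over `u` in the covering of `G`. -/
def layers (hG : G.IsSixLarge) (u : W) : ℕ → Layer G
  | 0 => Layer.base G u
  | i + 1 => (layers hG u i).next hG

/-- The vertices of the covering of `G` obtained as the union of its spheres. -/
def Development (hG : G.IsSixLarge) (u : W) : Type := Σ i, (layers hG u i).carrier

namespace Development

variable {hG : G.IsSixLarge} {u : W}

/-- The projection of the covering. -/
def proj (z : Development hG u) : W := (layers hG u z.1).proj z.2

/-- Adjacency in the covering. -/
inductive Step : Development hG u → Development hG u → Prop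
  | same (i : ℕ) (s t : (layers hG u i).carrier) (h : (layers hG u i).adj.Adj s t) :
    Step ⟨i, s⟩ ⟨i, t⟩
  | up (i : ℕ) (s : (layers hG u i).carrier) (q : (layers hG u (i + 1)).carrier)
    (h : Layer.Below hG s q) : Step ⟨i, s⟩ ⟨i + 1, q⟩
  | down (i : ℕ) (s : (layers hG u i).carrier) (q : (layers hG u (i + 1)).carrier)
    (h : Layer.Below hG s q) : Step ⟨i + 1, q⟩ ⟨i, s⟩

lemma Step.symm {z z' : Development hG u} (h : Step z z') : Step z' z := by
  cases h with
  | same i s t h => exact .same i t s h.symm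
  | up i s q h => exact .down i s q h
  | down i s q h => exact .up i s q h

lemma Step.map_adj {z z' : Development hG u} (h : Step z z') : G.Adj z.proj z'.proj := by
  cases h with
  | same i s t h => exact (layers hG u i).map_adj h
  | up i s q h => exact h.adj
  | down i s q h => exact h.adj.symm

lemma Step.le {z z' : Development hG u} (h : Step z z') : z'.1 ≤ z.1 + 1 := by
  cases h <;> dsimp only <;> omega

variable (hG u) in
/-- The covering graph. -/
def graph : SimpleGraph (Development hG u) where
  Adj := Step
  symm := ⟨fun _ _ => Step.symm⟩
  loopless := ⟨fun _ h => h.map_adj.ne rfl⟩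

lemma Step.exists_lift {z : Development hG u} {y : W} (h : G.Adj z.proj y) :
    ∃ z', Step z z' ∧ z'.proj = y := by
  obtain ⟨i, s⟩ := z
  by_cases hu : (layers hG u i).IsUpper s y
  · obtain ⟨q, hq, rfl⟩ := hu.exists_below (hG := hG)
    exact ⟨⟨i + 1, q⟩, .up i s q hq, rfl⟩
  by_cases hl : y ∈ (layers hG u i).lower s
  · cases i with
    | zero => exact hl.elim
    | succ i =>
      obtain ⟨t, ht, rfl⟩ := hl
      exact ⟨⟨i, t⟩, .down i t s ht, rfl⟩
  · have : ∃ t, (layers hG u i).adj.Adj s t ∧ (layers hG u i).proj t = y := by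
      by_contra! hcon
      exact hu ⟨h, hl, hcon⟩
    obtain ⟨t, ht, rfl⟩ := this
    exact ⟨⟨i, t⟩, .same i s t ht, rfl⟩

lemma Step.unique {z z₁ z₂ : Development hG u} (h₁ : Step z z₁) (h₂ : Step z z₂)
    (h : z₁.proj = z₂.proj) : z₁ = z₂ := by
  cases h₁ with
  | same i s t h₁ =>
    cases h₂ with
    | same _ _ r h₂ => exact congrArg _ ((layers hG u i).proj_inj h₁ h₂ h)
    | up _ _ q h₂ => exact absurd h (h₂.isUpper.2.2 t h₁)
    | down i r _ h₂ => exact absurd ⟨r, h₂, h.symm⟩ ((layers hG u (i + 1)).proj_notMem_lower h₁)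
  | up i s q h₁ =>
    cases h₂ with
    | same _ _ r h₂ => exact absurd h.symm (h₁.isUpper.2.2 r h₂)
    | up _ _ q' h₂ => exact congrArg _ (h₁.eq_of_proj_eq h₂ (.inl rfl) h)
    | down i r _ h₂ => exact absurd ⟨r, h₂, h.symm⟩ h₁.isUpper.2.1
  | down i t q h₁ =>
    cases h₂ with
    | same _ _ r h₂ => exact absurd ⟨t, h₁, h⟩ ((layers hG u (i + 1)).proj_notMem_lower h₂)
    | up _ _ q' h₂ => exact absurd ⟨t, h₁, h⟩ h₂.isUpper.2.1
    | down _ r _ h₂ =>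
      rcases h₁.eq_or_adj h₂ with rfl | hadj
      · rfl
      · exact absurd h ((layers hG u i).map_adj hadj).ne

lemma Step.adj_of_adj {z z₁ z₂ : Development hG u} (h₁ : Step z z₁) (h₂ : Step z z₂)
    (h : G.Adj z₁.proj z₂.proj) : Step z₁ z₂ := by
  cases h₁ with
  | same i s t h₁ =>
    cases h₂ with
    | same _ _ r h₂ => exact .same i t r ((layers hG u i).adj_of_adj h₁ h₂ h)
    | up _ _ q h₂ => exact .up i t q (h₂.of_adj h₁ h)
    | down i r _ h₂ => exact .down i r t (h₂.of_nextAdj h₁ h.symm)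
  | up i s q h₁ =>
    cases h₂ with
    | same _ _ r h₂ => exact .down i r q (h₁.of_adj h₂ h.symm)
    | up _ _ q' h₂ => exact .same (i + 1) q q' ⟨⟨s, h₁, h₂⟩, h⟩
    | down i r _ h₂ => exact absurd h (h₁.isUpper.not_adj_lower ⟨r, h₂, rfl⟩)
  | down i t q h₁ =>
    cases h₂ with
    | same _ _ r h₂ => exact .up i t r (h₁.of_nextAdj h₂ h)
    | up _ _ q' h₂ => exact absurd h.symm (h₂.isUpper.not_adj_lower ⟨t, h₁, rfl⟩)
    | down _ r _ h₂ =>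
      exact .same i t r ((h₁.eq_or_adj h₂).resolve_left fun h' => h.ne (h' ▸ rfl))

theorem isTriangleCover : IsTriangleCover (graph hG u) G proj :=
  ⟨Step.map_adj, Step.exists_lift, Step.unique, Step.adj_of_adj⟩

lemma reachable (z : Development hG u) : (graph hG u).Reachable ⟨0, ()⟩ z := by
  obtain ⟨i, s⟩ := z
  induction i with
  | zero => exact .rfl
  | succ i ih =>
    obtain ⟨t, ht⟩ := Layer.exists_below (P := layers hG u i) s
    have : (graph hG u).Adj ⟨i, t⟩ ⟨i + 1, s⟩ := Step.up i t s ht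
    exact (ih t).trans this.reachable

end Development

end SimpleGraph

namespace SComplex

variable {W : Type} [DecidableEq W] {Y : SComplex W}

lemma KLarge.isSixLarge (hY : Y.KLarge 6) : Y.edgeGraph.IsSixLarge where
  four := by
    intro a b c d hab hbc hcd hda hac hbd
    obtain ⟨i, j, h₁, h₂, h₃, h⟩ := hY.2 4 ![a, b, c, d] ⟨by norm_num, by
      intro i j hij
      have := hab.ne; have := hbc.ne; have := hcd.ne; have := hda.ne
      fin_cases i <;> fin_cases j <;> first | rfl | (exfalso; simp_all), by
      intro i
      fin_cases i
      exacts [hab.2, hbc.2, hcd.2, hda.2]⟩ le_rfl (by norm_num)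
    rw [Y.edgeGraph_adj, Y.edgeGraph_adj]
    fin_cases i <;> fin_cases j <;> first
      | exact absurd rfl h₁ | exact absurd rfl h₂ | exact absurd rfl h₃
      | exact .inl ⟨hac, h⟩ | exact .inr ⟨hbd, h⟩
      | exact .inl ⟨hac, Finset.pair_comm c a ▸ h⟩ | exact .inr ⟨hbd, Finset.pair_comm d b ▸ h⟩
  five := by
    intro a b c d e hab hbc hcd hde hea hac had hbd hbe hce
    obtain ⟨i, j, h₁, h₂, h₃, h⟩ := hY.2 5 ![a, b, c, d, e] ⟨by norm_num, by
      intro i j hij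
      have := hab.ne; have := hbc.ne; have := hcd.ne; have := hde.ne; have := hea.ne
      fin_cases i <;> fin_cases j <;> first | rfl | (exfalso; simp_all), by
      intro i
      fin_cases i
      exacts [hab.2, hbc.2, hcd.2, hde.2, hea.2]⟩ (by norm_num) (by norm_num)
    simp only [Y.edgeGraph_adj]
    fin_cases i <;> fin_cases j <;> first
      | exact absurd rfl h₁ | exact absurd rfl h₂ | exact absurd rfl h₃
      | exact .inl ⟨hac, h⟩ | exact .inl ⟨hac, Finset.pair_comm c a ▸ h⟩
      | exact .inr (.inl ⟨had, h⟩) | exact .inr (.inl ⟨had, Finset.pair_comm d a ▸ h⟩)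
      | exact .inr (.inr (.inl ⟨hbd, h⟩))
      | exact .inr (.inr (.inl ⟨hbd, Finset.pair_comm d b ▸ h⟩))
      | exact .inr (.inr (.inr (.inl ⟨hbe, h⟩)))
      | exact .inr (.inr (.inr (.inl ⟨hbe, Finset.pair_comm e b ▸ h⟩)))
      | exact .inr (.inr (.inr (.inr ⟨hce, h⟩)))
      | exact .inr (.inr (.inr (.inr ⟨hce, Finset.pair_comm e c ▸ h⟩)))

lemma Flag.mem_faces (hY : Y.Flag) {A : Finset W} (hA : A.Nonempty)
    (hv : ∀ v ∈ A, ({v} : Finset W) ∈ Y.faces)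
    (h : ∀ v ∈ A, ∀ w ∈ A, v = w ∨ Y.edgeGraph.Adj v w) : A ∈ Y.faces :=
  hY A hA hv fun v hv w hw hne => ((h v hv w hw).resolve_left hne).2

lemma mem_faces_of_adj {a b : W} (h : Y.edgeGraph.Adj a b) : ({a} : Finset W) ∈ Y.faces :=
  Y.down_closed _ h.2 _ (by simp) (by simp)

end SComplex

namespace SimpleGraph.Layer

variable {W : Type} {G : SimpleGraph W}

/-- Helly property: the sets `lower t` for `t` in a finite clique have a common point. -/
lemma exists_mem_lower_of_clique (hG : G.IsSixLarge) (P : Layer G)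
    (hne : ∀ s, (P.lower s).Nonempty) (R : List P.carrier) : ∀ a b,
    (∀ s ∈ a :: b :: R, ∀ t ∈ a :: b :: R, s = t ∨ P.adj.Adj s t) →
    ∃ w, ∀ s ∈ a :: b :: R, w ∈ P.lower s := by
  induction R with
  | nil =>
    intro a b h
    rcases h a (by simp) b (by simp) with rfl | hab
    · obtain ⟨w, hw⟩ := hne a
      exact ⟨w, by simpa using hw⟩
    · obtain ⟨w, ha, hb⟩ := P.exists_mem_lower hab
      exact ⟨w, by simp [ha, hb]⟩
  | cons c R ih =>
    intro a b h
    obtain ⟨w, hw⟩ := ih a c fun s hs t ht =>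
      h s (by simp at hs ⊢; tauto) t (by simp at ht ⊢; tauto)
    obtain ⟨w', hw'⟩ := ih b c fun s hs t ht =>
      h s (by simp at hs ⊢; tauto) t (by simp at ht ⊢; tauto)
    simp only [List.forall_mem_cons] at hw hw' ⊢
    by_cases hwb : w ∈ P.lower b
    · exact ⟨w, hw.1, hwb, hw.2⟩
    by_cases hwa : w' ∈ P.lower a
    · exact ⟨w', hwa, hw'⟩
    exfalso
    rcases h a (by simp) b (by simp) with rfl | hab
    · exact hwb hw.1
    have hww : w ≠ w' := by
      rintro rfl
      exact hwa hw.1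
    have h₁ : P.proj a ≠ w' := by
      rintro rfl
      exact P.proj_notMem_lower hab.symm hw'.1
    have h₂ : P.proj b ≠ w := by
      rintro rfl
      exact P.proj_notMem_lower hab hw.1
    rcases hG.four (P.map_adj hab) (P.adj_of_mem_lower hw'.1)
      (P.lower_clique hw.2.1 hw'.2.1 hww).symm (P.adj_of_mem_lower hw.1).symm h₁ h₂ with h | h
    · exact hwa (P.mem_lower_of_adj hab.symm hw'.1 h.symm)
    · exact hwb (P.mem_lower_of_adj hab hw.1 h.symm)

end SimpleGraph.Layer

namespace SComplex

open SimpleGraph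

variable {W : Type} [DecidableEq W] {Y : SComplex W} {n : ℕ}

lemma IsChamberComplex.exists_adj (hcc : Y.IsChamberComplex n) (hn : 1 ≤ n) {u : W}
    (hu : ({u} : Finset W) ∈ Y.faces) : ∃ x, Y.edgeGraph.Adj u x := by
  obtain ⟨τ, hτ, hsub, hcard⟩ := hcc.2.1 _ hu
  obtain ⟨x, hx, hne⟩ := Finset.exists_mem_ne (s := τ) (by omega) u
  exact ⟨x, (Y.eq_or_adj_of_mem hτ (hsub (by simp)) hx).resolve_left hne.symm⟩

/-- For every vertex `w` of a face `A` of a flag chamber complex there is a vertex adjacent to all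
vertices of `A` other than `w` and not to `w`. -/
lemma IsChamberComplex.exists_opposite (hcc : Y.IsChamberComplex n) (hn : 1 ≤ n) (hY : Y.Flag)
    {A : Finset W} (hA : A ∈ Y.faces) {w : W} (hw : w ∈ A) :
    ∃ y, y ≠ w ∧ ¬ Y.edgeGraph.Adj y w ∧ ∀ a ∈ A, a ≠ w → Y.edgeGraph.Adj a y := by
  obtain ⟨C, hC, hAC, hcard⟩ := hcc.2.1 _ hA
  have hwC := hAC hw
  have hDcard : (C.erase w).card = n := by rw [Finset.card_erase_of_mem hwC, hcard]; rfl
  have hD : C.erase w ∈ Y.faces := Y.down_closed _ hC _ (Finset.erase_subset _ _)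
    (Finset.card_pos.mp (by omega))
  obtain ⟨τ, hτ, hsub, hτcard, hτC⟩ : ∃ τ ∈ Y.faces, C.erase w ⊆ τ ∧ τ.card = n + 1 ∧ τ ≠ C := by
    obtain ⟨τ₁, h₁, τ₂, h₂, hne, hs₁, hs₂, hc₁, hc₂⟩ := hcc.2.2 _ hD hDcard
    by_cases h : τ₁ = C
    · exact ⟨τ₂, h₂, hs₂, hc₂, fun h' => hne (h.trans h'.symm)⟩
    · exact ⟨τ₁, h₁, hs₁, hc₁, h⟩
  obtain ⟨y, hyτ, hyC⟩ : ∃ y ∈ τ, y ∉ C := by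
    by_contra! h
    exact hτC (Finset.eq_of_subset_of_card_le h (by omega))
  have hyD : ∀ a ∈ C, a ≠ w → Y.edgeGraph.Adj a y := fun a ha hne =>
    (Y.eq_or_adj_of_mem hτ (hsub (by simp [ha, hne])) hyτ).resolve_left
      (by rintro rfl; exact hyC ha)
  refine ⟨y, by rintro rfl; exact hyC hwC, fun hyw => ?_, fun a ha => hyD a (hAC ha)⟩
  have hyall : ∀ a ∈ C, Y.edgeGraph.Adj a y := fun a ha => by
    by_cases h : a = w
    · exact h ▸ hyw.symm
    · exact hyD a ha h
  have hins : insert y C ∈ Y.faces := by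
    refine hY.mem_faces (Finset.insert_nonempty _ _) (fun v hv => ?_) fun a ha b hb => ?_
    · rcases Finset.mem_insert.mp hv with rfl | hv
      · exact mem_faces_of_adj hyw
      · exact Y.down_closed _ hC _ (by simpa) (by simp)
    · rcases Finset.mem_insert.mp ha with rfl | ha' <;>
      rcases Finset.mem_insert.mp hb with rfl | hb'
      · exact .inl rfl
      · exact .inr (hyall b hb').symm
      · exact .inr (hyall a ha')
      · exact Y.eq_or_adj_of_mem hC ha' hb'
  have := hcc.1 _ hins
  rw [Finset.card_insert_of_notMem hyC] at this
  omega

lemma IsChamberComplex.exists_isUpper (hcc : Y.IsChamberComplex n) (hn : 1 ≤ n) (hY : Y.KLarge 6)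
    (P : Layer Y.edgeGraph) [Nonempty P.carrier] (hne : ∀ s, (P.lower s).Nonempty) :
    ∃ s x, P.IsUpper s x := by
  classical
  by_contra! hup
  have hG := hY.isSixLarge
  have hvert : ∀ s, ({P.proj s} : Finset W) ∈ Y.faces := fun s =>
    mem_faces_of_adj (P.adj_of_mem_lower (hne s).choose_spec)
  let S : Set (Finset P.carrier) := {T | T.Nonempty ∧ ∀ s ∈ T, ∀ t ∈ T, s = t ∨ P.adj.Adj s t}
  have himg : ∀ T ∈ S, ∀ a ∈ T.image P.proj, ∀ b ∈ T.image P.proj, a = b ∨ Y.edgeGraph.Adj a b := by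
    intro T hT a ha b hb
    obtain ⟨s, hs, rfl⟩ := Finset.mem_image.mp ha
    obtain ⟨t, ht, rfl⟩ := Finset.mem_image.mp hb
    exact (hT.2 s hs t ht).imp (congrArg _) P.map_adj
  have hvimg : ∀ T ∈ S, ∀ v ∈ T.image P.proj, ({v} : Finset W) ∈ Y.faces := by
    intro T hT v hv
    obtain ⟨s, hs, rfl⟩ := Finset.mem_image.mp hv
    exact hvert s
  have hcard : ∀ T ∈ S, T.card ≤ n + 1 := by
    intro T hT
    have hinj : Set.InjOn P.proj T := fun s hs t ht h =>
      (hT.2 s hs t ht).resolve_right fun hst => (P.map_adj hst).ne h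
    rw [← Finset.card_image_of_injOn hinj]
    exact hcc.1 _ (hY.1.mem_faces (hT.1.image _) (hvimg T hT) (himg T hT))
  obtain ⟨T, hT, hmax⟩ : ∃ T ∈ S, ∀ T' ∈ S, T'.card ≤ T.card := by
    obtain ⟨s₀⟩ := ‹Nonempty P.carrier›
    have hfin : (Finset.card '' S).Finite :=
      (Set.finite_Iic (n + 1)).subset (Set.image_subset_iff.mpr hcard)
    obtain ⟨_, ⟨T, hT, rfl⟩, hm⟩ := hfin.exists_maximalFor id _
      ⟨_, {s₀}, ⟨by simp, by simp⟩, rfl⟩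
    exact ⟨T, hT, fun T' hT' => by
      by_contra! h
      exact absurd (hm ⟨T', hT', rfl⟩ h.le) (by simpa using h)⟩
  obtain ⟨t₀, ht₀⟩ := hT.1
  obtain ⟨w, hw⟩ := P.exists_mem_lower_of_clique hG hne T.toList t₀ t₀ fun s hs t ht =>
    hT.2 s (by simp at hs; aesop) t (by simp at ht; aesop)
  replace hw : ∀ t ∈ T, w ∈ P.lower t := fun t ht => hw t (by simp [ht])
  have hwadj : ∀ a ∈ T.image P.proj, Y.edgeGraph.Adj a w := by
    simpa using fun t ht => P.adj_of_mem_lower (hw t ht)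
  have hA : insert w (T.image P.proj) ∈ Y.faces := by
    refine hY.1.mem_faces (Finset.insert_nonempty _ _) (fun v hv => ?_) fun a ha b hb => ?_
    · rcases Finset.mem_insert.mp hv with rfl | hv
      · exact mem_faces_of_adj (hwadj _ (Finset.mem_image_of_mem _ ht₀)).symm
      · exact hvimg T hT v hv
    · rcases Finset.mem_insert.mp ha with rfl | ha' <;>
      rcases Finset.mem_insert.mp hb with rfl | hb'
      · exact .inl rfl
      · exact .inr (hwadj b hb').symm
      · exact .inr (hwadj a ha')
      · exact himg T hT a ha' b hb'
  obtain ⟨y, hyw, hnadj, hy⟩ := hcc.exists_opposite hn hY.1 hA (Finset.mem_insert_self _ _)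
  have hyT : ∀ t ∈ T, Y.edgeGraph.Adj (P.proj t) y := fun t ht =>
    have hmem := Finset.mem_image_of_mem P.proj ht
    hy _ (Finset.mem_insert_of_mem hmem) (hwadj _ hmem).ne
  by_cases hlow : y ∈ P.lower t₀
  · exact hnadj (P.lower_clique hlow (hw t₀ ht₀) hyw)
  obtain ⟨r, hr, rfl⟩ : ∃ r, P.adj.Adj t₀ r ∧ P.proj r = y := by
    by_contra! h
    exact hup t₀ y ⟨hyT t₀ ht₀, hlow, h⟩
  have hrT : ∀ t ∈ T, P.adj.Adj r t := fun t ht => by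
    rcases hT.2 t₀ ht₀ t ht with rfl | h
    · exact hr.symm
    · exact P.adj_of_adj hr h (hyT t ht).symm
  have hins : insert r T ∈ S := by
    refine ⟨Finset.insert_nonempty _ _, fun s hs t ht => ?_⟩
    rcases Finset.mem_insert.mp hs with rfl | hs' <;> rcases Finset.mem_insert.mp ht with rfl | ht'
    · exact .inl rfl
    · exact .inr (hrT t ht')
    · exact .inr (hrT s hs').symm
    · exact hT.2 s hs' t ht'
  have := hmax _ hins
  rw [Finset.card_insert_of_notMem fun h => (hrT r h).ne rfl] at this
  omega

lemma IsChamberComplex.nonempty_layers (hcc : Y.IsChamberComplex n) (hn : 1 ≤ n)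
    (hY : Y.KLarge 6) {u : W} (hu : ({u} : Finset W) ∈ Y.faces) (i : ℕ) :
    Nonempty (layers hY.isSixLarge u i).carrier := by
  induction i with
  | zero => exact ⟨()⟩
  | succ i ih =>
    obtain ⟨s, x, hs⟩ : ∃ s x, (layers hY.isSixLarge u i).IsUpper s x := by
      cases i with
      | zero =>
        obtain ⟨x, hx⟩ := hcc.exists_adj hn hu
        exact ⟨(), x, hx, fun h => h, fun _ h => h.elim⟩
      | succ i =>
        refine hcc.exists_isUpper hn hY _ fun q => ?_
        obtain ⟨s, hs⟩ := Layer.exists_below q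
        exact ⟨_, s, hs, rfl⟩
    obtain ⟨q, -⟩ := hs.exists_below (hG := hY.isSixLarge)
    exact ⟨q⟩

end SComplex

/-- The part of the fiber product of `p` and `q` over `W` given by the tensor product of graphs. -/
def fiberGraph {Z V W : Type*} (H : SimpleGraph Z) (K : SimpleGraph V) (q : Z → W) (p : V → W) :
    SimpleGraph {a : Z × V // q a.1 = p a.2} where
  Adj a b := H.Adj a.1.1 b.1.1 ∧ K.Adj a.1.2 b.1.2
  symm := ⟨fun _ _ h => ⟨h.1.symm, h.2.symm⟩⟩
  loopless := ⟨fun _ h => h.1.ne rfl⟩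

lemma IsTriangleCover.fiberGraph {Z V W : Type*} {H : SimpleGraph Z} {G : SimpleGraph W}
    {q : Z → W} (hc : IsTriangleCover H G q) (K : SimpleGraph V) {p : V → W}
    (hp : ∀ {a b}, K.Adj a b → G.Adj (p a) (p b)) :
    IsTriangleCover (fiberGraph H K q p) K (fun a => a.1.2) where
  map_adj h := h.2
  exists_lift := by
    rintro ⟨⟨z, v⟩, hz⟩ y hy
    obtain ⟨z', hz', h⟩ := hc.exists_lift (z := z) (y := p y) (by rw [hz]; exact hp hy)
    exact ⟨⟨(z', y), h⟩, ⟨hz', hy⟩, rfl⟩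
  lift_unique := by
    rintro ⟨⟨z, v⟩, hz⟩ ⟨⟨z₁, v₁⟩, hz₁⟩ ⟨⟨z₂, v₂⟩, hz₂⟩ h₁ h₂ (rfl : v₁ = v₂)
    obtain rfl : z₁ = z₂ := hc.lift_unique h₁.1 h₂.1 (hz₁.trans hz₂.symm)
    rfl
  adj_of_adj := by
    rintro ⟨⟨z, v⟩, hz⟩ ⟨⟨z₁, v₁⟩, hz₁⟩ ⟨⟨z₂, v₂⟩, hz₂⟩ h₁ h₂ h
    refine ⟨hc.adj_of_adj h₁.1 h₂.1 ?_, h⟩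
    dsimp only at hz₁ hz₂ ⊢
    rw [hz₁, hz₂]
    exact hp h

/-- Paths of `H` lift to the fiber product along a map `p` that lifts edges at the points of `S`. -/
lemma exists_reachable_fiberGraph {Z V W : Type*} {H : SimpleGraph Z} {K : SimpleGraph V}
    {G : SimpleGraph W} {q : Z → W} {p : V → W} (hq : ∀ {a b}, H.Adj a b → G.Adj (q a) (q b))
    (S : Set V) (hp : ∀ {v y}, v ∈ S → G.Adj (p v) y → ∃ v' ∈ S, K.Adj v v' ∧ p v' = y)
    (a : {a : Z × V // q a.1 = p a.2}) (ha : a.1.2 ∈ S) {z : Z} (h : H.Reachable a.1.1 z) :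
    ∃ b, (fiberGraph H K q p).Reachable a b ∧ b.1.1 = z ∧ b.1.2 ∈ S := by
  obtain ⟨c⟩ := h
  obtain ⟨⟨z₀, v⟩, hz⟩ := a
  dsimp only at c ha
  induction c generalizing v with
  | nil => exact ⟨_, .refl _, rfl, ha⟩
  | cons hadj c ih =>
    obtain ⟨v', hS, hv', h⟩ := hp ha (by have := hq hadj; rwa [hz] at this)
    obtain ⟨b, hb, hbz⟩ := ih v' h.symm hS
    exact ⟨b, .trans (SimpleGraph.Adj.reachable ⟨hadj, hv'⟩) hb, hbz⟩

section Covering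

variable {V W : Type} [DecidableEq V] [DecidableEq W] {p : V → W} {X : SComplex V} {Y : SComplex W}

lemma IsSimplicialCovering.map_adj (h : IsSimplicialCovering p X Y) {a b : V}
    (hab : X.edgeGraph.Adj a b) : Y.edgeGraph.Adj (p a) (p b) := by
  obtain ⟨h₁, h₂⟩ := h.1 _ hab.2
  refine ⟨fun he => hab.1 (h₂ (by simp) (by simp) he), ?_⟩
  simpa [Finset.image_insert] using h₁

lemma IsSimplicialCovering.exists_adj (h : IsSimplicialCovering p X Y) {v : V}
    (hv : v ∈ X.vertexSet) {y : W} (hy : Y.edgeGraph.Adj (p v) y) :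
    ∃ v' ∈ X.vertexSet, X.edgeGraph.Adj v v' ∧ p v' = y := by
  obtain ⟨σ, ⟨hσ, hvσ, himg⟩, -⟩ := h.2.2 v hv _ hy.2 (by simp)
  obtain ⟨v', hv', rfl⟩ := Finset.mem_image.mp (show y ∈ σ.image p by simp [himg])
  exact ⟨v', X.down_closed _ hσ _ (by simpa) (by simp),
    (X.eq_or_adj_of_mem hσ hvσ hv').resolve_left fun he => hy.ne (he ▸ rfl), rfl⟩

end Covering

/-- **Corollary (Osajda, Corollary 4.3).** The universal cover of a `6`-large chamber
complex of dimension at least `1` is unbounded (in the combinatorial distance on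
vertices). -/
theorem universal_cover_unbounded {V W : Type} [DecidableEq V] [DecidableEq W]
    (Y : SComplex W) (n : ℕ) (hn : 1 ≤ n) (hY : Y.KLarge 6)
    (hcc : Y.IsChamberComplex n) (hYconn : ConnectedSpace Y.realization)
    (X : SComplex V) (p : V → W) (hcov : IsUniversalCover p X Y) :
    ∀ m : ℕ, ∃ u v : V, ({u} : Finset V) ∈ X.faces ∧ ({v} : Finset V) ∈ X.faces ∧
      ({v} : Finset V) ∉ X.ballFaces {u} m := by
  intro m
  obtain ⟨hp, hconn, hsc⟩ := hcov
  obtain ⟨⟨f, -, σ, hσ, -⟩⟩ := hconn.toNonempty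
  obtain ⟨x₀, hx₀σ⟩ := X.nonempty_of_mem σ hσ
  have hx₀ : ({x₀} : Finset V) ∈ X.faces := X.down_closed _ hσ _ (by simpa) (by simp)
  have hu : ({p x₀} : Finset W) ∈ Y.faces := by simpa using (hp.1 _ hx₀).1
  have hG := hY.isSixLarge
  have hD := SimpleGraph.Development.isTriangleCover (hG := hG) (u := p x₀)
  have hF := hD.fiberGraph X.edgeGraph hp.map_adj
  let o : {a : SimpleGraph.Development hG (p x₀) × V // a.1.proj = p a.2} := ⟨(⟨0, ()⟩, x₀), rfl⟩
  obtain ⟨s⟩ := hcc.nonempty_layers hn hY hu (m + 1)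
  obtain ⟨⟨⟨z, v⟩, hz⟩, hov, rfl, hv⟩ := exists_reachable_fiberGraph
    (K := X.edgeGraph) hD.map_adj X.vertexSet
    (fun hv hy => hp.exists_adj hv hy) o hx₀ (SimpleGraph.Development.reachable ⟨m + 1, s⟩)
  have key : ∀ i w, ({w} : Finset V) ∈ X.ballFaces {x₀} i →
      ∃ b, (fiberGraph (SimpleGraph.Development.graph hG (p x₀)) X.edgeGraph _ p).Reachable o b ∧
        b.1.2 = w ∧ b.1.1.1 ≤ i := by
    intro i
    induction i with
    | zero =>
      rintro w ⟨-, hw⟩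
      exact ⟨o, .refl _, (Finset.mem_singleton.mp (hw (by simp))).symm, le_rfl⟩
    | succ i ih =>
      rintro w ⟨-, τ, hτ, hwτ, w', hw'τ, hw'⟩
      obtain ⟨b, hb, rfl, hi⟩ := ih w' hw'
      rcases X.eq_or_adj_of_mem hτ hw'τ (hwτ (Finset.mem_singleton_self w)) with rfl | hadj
      · exact ⟨b, hb, rfl, by omega⟩
      · obtain ⟨b', hb', rfl⟩ := hF.exists_lift hadj
        exact ⟨b', hb.trans hb'.reachable, rfl, hb'.1.le.trans (by omega)⟩
  refine ⟨x₀, v, hx₀, hv, fun hball => ?_⟩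
  obtain ⟨b, hb, hbv, hle⟩ := key m v hball
  obtain rfl := X.eq_of_reachable hF (hbv ▸ hv) (hb.symm.trans hov) hbv
  simp at hle
end
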